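/- arXiv:math/0103180 — 2 statements merged into one kernel-verified Lean document; each statement's English description precedes it below -/
import Mathlib

section
/- Let f : ℝ → ℝ be C² and g : ℝ → ℝ be C³ on an interval [a,b] containing 0, with f(0) = g(0) = 0, g'(0) > 0, g''(0) = 0 and f''(0) = 0, and suppose the origin is a center of x'' + f(x)x' + g(x) = 0 with period function T. Let C(x) = g(x)/g'(0) − (1/(g'(0)·x³))·(∫₀ˣ s·f(s) ds)² for x ≠ 0, C(0) = 0. If C''(x) = 0 for all x in an interval J containing 0, then T is constant on some interval (0,ε), i.e. the center is isochronous. -/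
open Set Real

/-- A (C²) solution of the Liénard equation `x'' + f(x)x' + g(x) = 0`. -/
def IsLienardSolution (f g : ℝ → ℝ) (u : ℝ → ℝ) : Prop :=
  ContDiff ℝ 2 u ∧ ∀ t, deriv (deriv u) t + f (u t) * deriv u t + g (u t) = 0

/-- The averaged damping `φ(x) = x⁻² ∫₀ˣ s f(s) ds`. -/
noncomputable def averagedDamping (f : ℝ → ℝ) (x : ℝ) : ℝ := (∫ s in (0:ℝ)..x, s * f s) / x ^ 2

lemma averagedDamping_zero (f : ℝ → ℝ) : averagedDamping f 0 = 0 := by simp [averagedDamping]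

lemma averagedDamping_neg (f : ℝ → ℝ) (x : ℝ) :
    averagedDamping (fun s => -f s) x = -averagedDamping f x := by
  simp [averagedDamping, neg_div]

lemma abs_averagedDamping_le {f : ℝ → ℝ} {M x : ℝ} (hM : 0 ≤ M)
    (h : ∀ s, |s| ≤ |x| → |f s| ≤ M) : |averagedDamping f x| ≤ M := by
  rcases eq_or_ne x 0 with rfl | hx
  · simpa [averagedDamping] using hM
  have h1 : ‖∫ s in (0:ℝ)..x, s * f s‖ ≤ (|x| * M) * |x - 0| := by
    apply intervalIntegral.norm_integral_le_of_norm_le_const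
    intro s hs
    have hsx : |s| ≤ |x| := by
      rcases le_total 0 x with h0 | h0
      · rw [uIoc_of_le h0] at hs
        rw [abs_of_pos hs.1, abs_of_nonneg h0]
        exact hs.2
      · rw [uIoc_of_ge h0] at hs
        rw [abs_of_nonpos hs.2, abs_of_nonpos h0]
        linarith [hs.1]
    rw [Real.norm_eq_abs, abs_mul]
    exact mul_le_mul hsx (h s hsx) (abs_nonneg _) (abs_nonneg _)
  rw [averagedDamping, abs_div, abs_pow, div_le_iff₀ (by positivity)]
  rw [Real.norm_eq_abs, sub_zero] at h1
  linarith

lemma hasDerivAt_averagedDamping {f : ℝ → ℝ} (hf : Continuous f) {x : ℝ} (hx : x ≠ 0) :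
    HasDerivAt (averagedDamping f) ((f x - 2 * averagedDamping f x) / x) x := by
  have hc : Continuous fun s => s * f s := by fun_prop
  have h := (hc.integral_hasStrictDerivAt 0 x).hasDerivAt.div (hasDerivAt_pow 2 x)
    (pow_ne_zero 2 hx)
  refine h.congr_deriv ?_
  simp only [averagedDamping]
  field_simp
  norm_num
  ring

lemma tendsto_averagedDamping_zero {f : ℝ → ℝ} (hf : ContinuousAt f 0) (h0 : f 0 = 0) :
    Filter.Tendsto (averagedDamping f) (nhds 0) (nhds 0) := by
  rw [Metric.tendsto_nhds_nhds]
  intro ε hε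
  obtain ⟨d, hd, h⟩ := Metric.continuousAt_iff.1 hf (ε / 2) (half_pos hε)
  refine ⟨d, hd, fun {x} hx => ?_⟩
  simp only [Real.dist_eq, sub_zero, h0] at h hx ⊢
  have := abs_averagedDamping_le (f := f) (x := x) (half_pos hε).le
    (fun s hs => (h (hs.trans_lt hx)).le)
  linarith

lemma continuous_averagedDamping {f : ℝ → ℝ} (hf : Continuous f) (h0 : f 0 = 0) :
    Continuous (averagedDamping f) := by
  rw [continuous_iff_continuousAt]
  intro x
  rcases eq_or_ne x 0 with rfl | hx
  · simpa [ContinuousAt, averagedDamping_zero] using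
      tendsto_averagedDamping_zero hf.continuousAt h0
  · exact (hasDerivAt_averagedDamping hf hx).continuousAt

lemma hasDerivAt_id_mul_zero {φ : ℝ → ℝ} (hφ : ContinuousAt φ 0) :
    HasDerivAt (fun x => x * φ x) (φ 0) 0 := by
  rw [hasDerivAt_iff_tendsto_slope]
  refine (hφ.tendsto.mono_left nhdsWithin_le_nhds).congr' ?_
  filter_upwards [self_mem_nhdsWithin] with x hx
  have hx : x ≠ 0 := hx
  simp [slope_def_field, hx]

lemma hasDerivAt_mul_averagedDamping {f : ℝ → ℝ} (hf : Continuous f) (h0 : f 0 = 0) (x : ℝ) :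
    HasDerivAt (fun x => x * averagedDamping f x) (f x - averagedDamping f x) x := by
  rcases eq_or_ne x 0 with rfl | hx
  · refine (hasDerivAt_id_mul_zero (continuous_averagedDamping hf h0).continuousAt).congr_deriv ?_
    simp [averagedDamping_zero, h0]
  · refine ((hasDerivAt_id' x).mul (hasDerivAt_averagedDamping hf hx)).congr_deriv ?_
    field_simp
    ring

lemma hasDerivAt_mul_averagedDamping_sq {f : ℝ → ℝ} (hf : Continuous f) (h0 : f 0 = 0) (x : ℝ) :
    HasDerivAt (fun x => x * averagedDamping f x ^ 2)
      (averagedDamping f x * (2 * f x - 3 * averagedDamping f x)) x := by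
  rcases eq_or_ne x 0 with rfl | hx
  · refine (hasDerivAt_id_mul_zero
      ((continuous_averagedDamping hf h0).pow 2).continuousAt).congr_deriv ?_
    simp [averagedDamping_zero]
  · refine ((hasDerivAt_id' x).mul
      ((hasDerivAt_averagedDamping hf hx).pow 2)).congr_deriv ?_
    simp only [Pi.pow_apply]
    field_simp
    norm_num
    ring

lemma eq_self_of_deriv_deriv_eq_zero_right {C : ℝ → ℝ} {η : ℝ} (hC0 : C 0 = 0)
    (hC1 : HasDerivAt C 1 0) (hC2 : ContDiffOn ℝ 2 C (Ioo 0 η))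
    (h : ∀ x ∈ Ioo 0 η, deriv (deriv C) x = 0) : ∀ x ∈ Ioo 0 η, C x = x := by
  have hd1 : DifferentiableOn ℝ C (Ioo 0 η) := hC2.differentiableOn (by norm_num)
  have hd2 : DifferentiableOn ℝ (deriv C) (Ioo 0 η) :=
    ((contDiffOn_succ_iff_deriv_of_isOpen (n := 1) isOpen_Ioo).1 hC2).2.2.differentiableOn
      (by norm_num)
  obtain ⟨α, hα⟩ := isOpen_Ioo.exists_is_const_of_deriv_eq_zero isPreconnected_Ioo hd2 h
  have hlin : ∀ x ∈ Ioo 0 η, C x = α * x := by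
    intro x hx
    have hsub : Ioo 0 x ⊆ Ioo 0 η := Ioo_subset_Ioo_right hx.2.le
    obtain ⟨ξ, hξ, hs⟩ := exists_deriv_eq_slope C hx.1 (fun y hy => by
      rcases hy.1.eq_or_lt with rfl | h0
      · exact hC1.continuousAt.continuousWithinAt
      · exact ((hd1.differentiableAt (isOpen_Ioo.mem_nhds ⟨h0, hy.2.trans_lt hx.2⟩)).continuousAt
          ).continuousWithinAt) (hd1.mono hsub)
    rw [hα ξ (hsub hξ), hC0, sub_zero, sub_zero, eq_div_iff hx.1.ne'] at hs
    exact hs.symm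
  intro x hx
  have h1 : Filter.Tendsto (slope C 0) (nhdsWithin 0 (Ioi 0)) (nhds 1) :=
    (hasDerivAt_iff_tendsto_slope.1 hC1).mono_left (nhdsWithin_mono _ (fun y hy => ne_of_gt hy))
  have h2 : Filter.Tendsto (slope C 0) (nhdsWithin 0 (Ioi 0)) (nhds α) := by
    refine tendsto_const_nhds.congr' ?_
    filter_upwards [Ioo_mem_nhdsGT (hx.1.trans hx.2)] with y hy
    have := hy.1.ne'
    rw [slope_def_field, hlin y hy, hC0]
    field_simp
    simp
  rw [hlin x hx, tendsto_nhds_unique h2 h1, one_mul]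

lemma eq_self_of_deriv_deriv_eq_zero {C : ℝ → ℝ} {η : ℝ} (hC0 : C 0 = 0)
    (hC1 : HasDerivAt C 1 0) (hC2 : ContDiffOn ℝ 2 C (Ioo (-η) η \ {0}))
    (h : ∀ x ∈ Ioo (-η) η, deriv (deriv C) x = 0) : ∀ x ∈ Ioo (-η) η, C x = x := by
  intro x hx
  have hη : 0 < η := by linarith [hx.1, hx.2]
  rcases lt_trichotomy x 0 with hx0 | rfl | hx0
  · have hd : deriv (fun y => -C (-y)) = fun y => deriv C (-y) := by
      ext y
      rw [deriv.fun_neg, deriv_comp_neg, neg_neg]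
    have key := eq_self_of_deriv_deriv_eq_zero_right (C := fun y => -C (-y)) (η := η)
      (by simpa using hC0)
      (by
        have h1 : HasDerivAt C 1 (-0) := by simpa using hC1
        exact (h1.scomp 0 (hasDerivAt_neg 0)).neg.congr_deriv (by simp))
      (by
        refine (hC2.comp contDiff_neg.contDiffOn ?_).neg
        intro y hy
        exact ⟨⟨by linarith [hy.2], by linarith [hy.1]⟩, by simpa using hy.1.ne'⟩)
      (by
        intro y hy
        rw [hd, deriv_comp_neg, h (-y) ⟨by linarith [hy.2], by linarith [hy.1]⟩, neg_zero])
      (-x) ⟨by linarith, by linarith [hx.1]⟩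
    simp only [neg_neg] at key
    linarith
  · exact hC0
  · refine eq_self_of_deriv_deriv_eq_zero_right hC0 hC1 (hC2.mono ?_)
      (fun y hy => h y ⟨by linarith [hy.1], hy.2⟩) x ⟨hx0, hx.2⟩
    intro y hy
    exact ⟨⟨by linarith [hy.1], hy.2⟩, hy.1.ne'⟩

/-- `u` solves `u'' + f(u) u' + ω² u + u φ(u)² = 0` whenever `|u| ≤ η`, where `φ` is the averaged
damping of the bounded continuous function `f`. -/
structure IsIsochronousSolution (f : ℝ → ℝ) (M ω η : ℝ) (u : ℝ → ℝ) : Prop where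
  continuous_damping : Continuous f
  abs_damping_le : ∀ x, |f x| ≤ M
  damping_zero : f 0 = 0
  frequency_pos : 0 < ω
  contDiff : ContDiff ℝ 2 u
  eq : ∀ t, |u t| ≤ η →
    deriv (deriv u) t + f (u t) * deriv u t + (ω ^ 2 * u t + u t * averagedDamping f (u t) ^ 2) = 0

/-- The phase point of `u` in the coordinates where the angular velocity is constant. -/
noncomputable def phasePoint (f : ℝ → ℝ) (ω : ℝ) (u : ℝ → ℝ) (t : ℝ) : ℂ :=
  (u t : ℂ) + ((deriv u t + u t * averagedDamping f (u t)) / ω : ℝ) * Complex.I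

/-- The logarithm of the radial growth factor along `u`. -/
noncomputable def logGrowth (f u : ℝ → ℝ) (t : ℝ) : ℝ :=
  -∫ s in (0:ℝ)..t, averagedDamping f (u s)

@[simp] lemma phasePoint_re (f : ℝ → ℝ) (ω : ℝ) (u : ℝ → ℝ) (t : ℝ) :
    (phasePoint f ω u t).re = u t := by simp [phasePoint]

@[simp] lemma phasePoint_im (f : ℝ → ℝ) (ω : ℝ) (u : ℝ → ℝ) (t : ℝ) :
    (phasePoint f ω u t).im = (deriv u t + u t * averagedDamping f (u t)) / ω := by
  simp [phasePoint]

@[simp] lemma logGrowth_zero (f u : ℝ → ℝ) : logGrowth f u 0 = 0 := by simp [logGrowth]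

namespace IsIsochronousSolution

variable {f u : ℝ → ℝ} {M ω η : ℝ}

lemma damping_bound_nonneg (h : IsIsochronousSolution f M ω η u) : 0 ≤ M :=
  (abs_nonneg _).trans (h.abs_damping_le 0)

lemma abs_averagedDamping_le (h : IsIsochronousSolution f M ω η u) (x : ℝ) :
    |averagedDamping f x| ≤ M :=
  _root_.abs_averagedDamping_le h.damping_bound_nonneg fun s _ => h.abs_damping_le s

lemma hasDerivAt (h : IsIsochronousSolution f M ω η u) (t : ℝ) :
    HasDerivAt u (deriv u t) t :=
  (h.contDiff.differentiable (by norm_num) t).hasDerivAt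

lemma hasDerivAt_deriv (h : IsIsochronousSolution f M ω η u) (t : ℝ) :
    HasDerivAt (deriv u) (deriv (deriv u) t) t :=
  (((contDiff_succ_iff_deriv (n := 1)).1 h.contDiff).2.2.differentiable (by norm_num) t).hasDerivAt

lemma continuous_averagedDamping_comp (h : IsIsochronousSolution f M ω η u) :
    Continuous fun t => averagedDamping f (u t) :=
  (continuous_averagedDamping h.continuous_damping h.damping_zero).comp h.contDiff.continuous

lemma hasDerivAt_logGrowth (h : IsIsochronousSolution f M ω η u) (t : ℝ) :
    HasDerivAt (logGrowth f u) (-averagedDamping f (u t)) t :=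
  (h.continuous_averagedDamping_comp.integral_hasStrictDerivAt 0 t).hasDerivAt.neg

lemma continuous_logGrowth (h : IsIsochronousSolution f M ω η u) : Continuous (logGrowth f u) :=
  continuous_iff_continuousAt.2 fun t => (h.hasDerivAt_logGrowth t).continuousAt

lemma logGrowth_le (h : IsIsochronousSolution f M ω η u) {t : ℝ} (ht : 0 ≤ t) :
    logGrowth f u t ≤ M * t := by
  have := intervalIntegral.norm_integral_le_of_norm_le_const (a := 0) (b := t)
    (f := fun s => averagedDamping f (u s)) (C := M) (fun s _ => h.abs_averagedDamping_le (u s))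
  rw [sub_zero, abs_of_nonneg ht, Real.norm_eq_abs] at this
  exact (neg_le_abs _).trans this

lemma hasDerivAt_phasePoint (h : IsIsochronousSolution f M ω η u) {t : ℝ} (ht : |u t| ≤ η) :
    HasDerivAt (phasePoint f ω u)
      ((-averagedDamping f (u t) - ω * Complex.I) * phasePoint f ω u t) t := by
  have hω := h.frequency_pos.ne'
  have hy := ((h.hasDerivAt_deriv t).add
    ((hasDerivAt_mul_averagedDamping h.continuous_damping h.damping_zero (u t)).comp t
      (h.hasDerivAt t))).div_const ω
  refine ((h.hasDerivAt t).ofReal_comp.add (hy.ofReal_comp.mul_const Complex.I)).congr_deriv ?_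
  have he : deriv (deriv u) t = -(f (u t) * deriv u t) -
    (ω ^ 2 * u t + u t * averagedDamping f (u t) ^ 2) := by linarith [h.eq t ht]
  rw [he]
  apply Complex.ext
  · simp [-Complex.ofReal_pow]
    field_simp
    ring
  · simp [-Complex.ofReal_pow]
    field_simp
    ring

lemma phasePoint_eq (h : IsIsochronousSolution f M ω η u) {s t : ℝ} (hst : s ≤ t)
    (hu : ∀ r ∈ Icc s t, |u r| ≤ η) :
    phasePoint f ω u t = Real.exp (logGrowth f u t - logGrowth f u s) *
      Complex.exp (-(ω * (t - s) : ℝ) * Complex.I) * phasePoint f ω u s := by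
  have hd : ∀ r ∈ Icc s t, HasDerivAt (fun r : ℝ => Complex.exp (-(logGrowth f u r : ℂ) +
      ((ω * r : ℝ) : ℂ) * Complex.I) * phasePoint f ω u r) 0 r := by
    intro r hr
    have h1 : HasDerivAt (fun r : ℝ => -(logGrowth f u r : ℂ) +
        ((ω * r : ℝ) : ℂ) * Complex.I) (averagedDamping f (u r) + ω * Complex.I) r := by
      refine ((h.hasDerivAt_logGrowth r).ofReal_comp.neg.add
        (((hasDerivAt_id' r).const_mul ω).ofReal_comp.mul_const Complex.I)).congr_deriv ?_
      simp
    refine (h1.cexp.mul (h.hasDerivAt_phasePoint (hu r hr))).congr_deriv ?_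
    ring
  have key := constant_of_has_deriv_right_zero
    (fun r hr => (hd r hr).continuousAt.continuousWithinAt)
    (fun r hr => (hd r ⟨hr.1, hr.2.le⟩).hasDerivWithinAt) t ⟨hst, le_rfl⟩
  have h2 := congrArg (Complex.exp (logGrowth f u t - (ω * t : ℝ) * Complex.I) * ·) key
  simp only [← mul_assoc, ← Complex.exp_add] at h2
  rw [Complex.ofReal_exp, ← Complex.exp_add]
  convert h2 using 2
  · rw [show (logGrowth f u t - (ω * t : ℝ) * Complex.I +
      (-(logGrowth f u t : ℂ) + ((ω * t : ℝ) : ℂ) * Complex.I)) = 0 by ring]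
    simp
  · congr 1
    push_cast
    ring

lemma norm_phasePoint_eq (h : IsIsochronousSolution f M ω η u) {s t : ℝ} (hst : s ≤ t)
    (hu : ∀ r ∈ Icc s t, |u r| ≤ η) :
    ‖phasePoint f ω u t‖ =
      Real.exp (logGrowth f u t - logGrowth f u s) * ‖phasePoint f ω u s‖ := by
  rw [h.phasePoint_eq hst hu, norm_mul, norm_mul, ← Complex.ofReal_neg,
    Complex.norm_exp_ofReal_mul_I, Complex.norm_real, mul_one, Real.norm_eq_abs, Real.abs_exp]

lemma phasePoint_add_period (h : IsIsochronousSolution f M ω η u) {s : ℝ}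
    (hu : ∀ r ∈ Icc s (s + 2 * π / ω), |u r| ≤ η) :
    phasePoint f ω u (s + 2 * π / ω) =
      Real.exp (logGrowth f u (s + 2 * π / ω) - logGrowth f u s) * phasePoint f ω u s := by
  have hω := h.frequency_pos
  rw [h.phasePoint_eq (le_add_of_nonneg_right (by positivity)) hu]
  rw [show ω * (s + 2 * π / ω - s) = 2 * π by field_simp; ring]
  have : Complex.exp (-((2 * π : ℝ) : ℂ) * Complex.I) = 1 := by
    rw [neg_mul, Complex.exp_neg]
    push_cast
    rw [Complex.exp_two_pi_mul_I, inv_one]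
  rw [this, mul_one]

/-- Forward uniqueness, applied to `u` and its time translate. -/
lemma eq_translate (h : IsIsochronousSolution f M ω η u) {s t τ : ℝ} (hst : s ≤ t)
    (hu : ∀ r ∈ Icc s t, |u r| ≤ η) (huτ : ∀ r ∈ Icc s t, |u (r + τ)| ≤ η)
    (heq : phasePoint f ω u (s + τ) = phasePoint f ω u s) :
    u (t + τ) = u t ∧ phasePoint f ω u (t + τ) = phasePoint f ω u t := by
  have hω := h.frequency_pos
  have hM := h.damping_bound_nonneg
  set F : ℝ → ℝ := fun x => ∫ s in (0:ℝ)..x, f s with hF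
  have hF' : ∀ x, HasDerivAt F (f x) x := fun x =>
    (h.continuous_damping.integral_hasStrictDerivAt 0 x).hasDerivAt
  set G : ℝ → ℝ := fun x => ω ^ 2 * x + x * averagedDamping f x ^ 2 with hG
  have hG' : ∀ x, HasDerivAt G (ω ^ 2 * 1 +
      averagedDamping f x * (2 * f x - 3 * averagedDamping f x)) x := fun x =>
    ((hasDerivAt_id' x).const_mul (ω ^ 2)).add
      (hasDerivAt_mul_averagedDamping_sq h.continuous_damping h.damping_zero x)
  have hFL : LipschitzWith M.toNNReal F := by
    apply lipschitzWith_of_nnnorm_deriv_le (fun x => (hF' x).differentiableAt)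
    intro x
    rw [(hF' x).deriv, ← NNReal.coe_le_coe, coe_nnnorm, Real.coe_toNNReal _ hM]
    exact h.abs_damping_le x
  have hGL : LipschitzWith (ω ^ 2 + 5 * M ^ 2).toNNReal G := by
    apply lipschitzWith_of_nnnorm_deriv_le (fun x => (hG' x).differentiableAt)
    intro x
    rw [(hG' x).deriv, ← NNReal.coe_le_coe, coe_nnnorm, Real.coe_toNNReal _ (by positivity)]
    have h1 := abs_le.1 (h.abs_averagedDamping_le x)
    have h2 := abs_le.1 (h.abs_damping_le x)
    rw [Real.norm_eq_abs, abs_le]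
    constructor <;> nlinarith
  have hv : LipschitzWith (max (1 + M.toNNReal * 1) ((ω ^ 2 + 5 * M ^ 2).toNNReal * 1))
      (fun p : ℝ × ℝ => (p.2 - F p.1, -G p.1)) :=
    ((LipschitzWith.prod_snd).sub (hFL.comp LipschitzWith.prod_fst)).prodMk
      (hGL.comp LipschitzWith.prod_fst).neg
  have hsys : ∀ r, |u r| ≤ η → HasDerivAt (fun r => (u r, deriv u r + F (u r)))
      (deriv u r + F (u r) - F (u r), -G (u r)) r := by
    intro r hr
    refine ((h.hasDerivAt r).prodMk ((h.hasDerivAt_deriv r).add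
      ((hF' (u r)).comp r (h.hasDerivAt r)))).congr_deriv ?_
    ext
    · simp
    · simp only [hG]
      linarith [h.eq r hr]
  have hsysτ : ∀ r ∈ Icc s t, HasDerivAt (fun r => (u (r + τ), deriv u (r + τ) + F (u (r + τ))))
      (deriv u (r + τ) + F (u (r + τ)) - F (u (r + τ)), -G (u (r + τ))) r := fun r hr =>
    (hsys (r + τ) (huτ r hr)).comp_add_const r τ
  have hus : u (s + τ) = u s := by simpa using congrArg Complex.re heq
  have hds : deriv u (s + τ) = deriv u s := by
    have := congrArg Complex.im heq
    rw [phasePoint_im, phasePoint_im, hus, div_left_inj' hω.ne'] at this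
    linarith
  have key := ODE_solution_unique (v := fun _ p => (p.2 - F p.1, -G p.1)) (fun _ => hv)
    (fun r hr => (hsysτ r hr).continuousAt.continuousWithinAt)
    (fun r hr => (hsysτ r ⟨hr.1, hr.2.le⟩).hasDerivWithinAt)
    (fun r hr => (hsys r (hu r hr)).continuousAt.continuousWithinAt)
    (fun r hr => (hsys r (hu r ⟨hr.1, hr.2.le⟩)).hasDerivWithinAt)
    (by rw [hus, hds]) ⟨hst, le_rfl⟩
  have hut : u (t + τ) = u t := congrArg Prod.fst key
  have hdt : deriv u (t + τ) = deriv u t := by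
    have := congrArg Prod.snd key
    simp only [hut] at this
    linarith
  refine ⟨hut, ?_⟩
  rw [phasePoint, hut, hdt, phasePoint]

/-- If the radial growth over one turn is trivial, it stays trivial and `u` repeats itself. -/
lemma eq_add_period_of_logGrowth_eq (h : IsIsochronousSolution f M ω η u) {s t : ℝ} (hst : s ≤ t)
    (hu : ∀ r ∈ Icc s (t + 2 * π / ω), |u r| ≤ η) (ht : phasePoint f ω u t ≠ 0)
    (hs : logGrowth f u (s + 2 * π / ω) = logGrowth f u s) :
    u (t + 2 * π / ω) = u t ∧ logGrowth f u (t + 2 * π / ω) = logGrowth f u t := by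
  have hω := h.frequency_pos
  have hτ : 0 < 2 * π / ω := by positivity
  have hzs := h.phasePoint_add_period (s := s) fun r hr => hu r ⟨hr.1, by linarith [hr.2]⟩
  rw [hs, sub_self, Real.exp_zero, Complex.ofReal_one, one_mul] at hzs
  obtain ⟨h1, h2⟩ := h.eq_translate hst (fun r hr => hu r ⟨hr.1, by linarith [hr.2]⟩)
    (fun r hr => hu _ ⟨by linarith [hr.1], by linarith [hr.2]⟩) hzs
  refine ⟨h1, ?_⟩
  have hzt := h.norm_phasePoint_eq (le_add_of_nonneg_right hτ.le : t ≤ t + 2 * π / ω)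
    fun r hr => hu r ⟨by linarith [hr.1], hr.2⟩
  rw [h2, eq_comm, mul_eq_right₀ (norm_ne_zero_iff.2 ht), Real.exp_eq_one_iff] at hzt
  linarith

lemma phasePoint_ne_zero (h : IsIsochronousSolution f M ω η u) {t : ℝ} (ht : 0 ≤ t)
    (hu : ∀ r ∈ Icc 0 t, |u r| ≤ η) (h0 : phasePoint f ω u 0 ≠ 0) : phasePoint f ω u t ≠ 0 := by
  rw [← norm_ne_zero_iff, h.norm_phasePoint_eq ht hu]
  exact mul_ne_zero (Real.exp_ne_zero _) (norm_ne_zero_iff.2 h0)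

lemma logGrowth_add_period_le (h : IsIsochronousSolution f M ω η u)
    (h0 : phasePoint f ω u 0 ≠ 0) (hL : logGrowth f u (2 * π / ω) ≤ 0) {t : ℝ} (ht : 0 ≤ t)
    (hu : ∀ r ∈ Icc 0 (t + 2 * π / ω), |u r| ≤ η) :
    logGrowth f u (t + 2 * π / ω) ≤ logGrowth f u t := by
  have hω := h.frequency_pos
  have hτ : 0 < 2 * π / ω := by positivity
  by_contra! hlt
  have hz := h.phasePoint_ne_zero ht (fun r hr => hu r ⟨hr.1, by linarith [hr.2]⟩) h0
  have hc : ContinuousOn (fun s => logGrowth f u (s + 2 * π / ω) - logGrowth f u s) (Icc 0 t) :=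
    ((h.continuous_logGrowth.comp (continuous_add_const _)).sub h.continuous_logGrowth).continuousOn
  obtain ⟨s, hs, hs0⟩ := intermediate_value_Icc ht hc
    (show (0:ℝ) ∈ Icc _ _ from ⟨by simpa using hL, by simpa using hlt.le⟩)
  have := (h.eq_add_period_of_logGrowth_eq hs.2
    (fun r hr => hu r ⟨hs.1.trans hr.1, hr.2⟩) hz (sub_eq_zero.1 hs0)).2
  exact hlt.ne' this

end IsIsochronousSolution

lemma abs_le_of_bootstrap {u : ℝ → ℝ} (hu : Continuous u) {η N : ℝ} (hη : 0 < η)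
    (h0 : |u 0| ≤ η)
    (h : ∀ S ∈ Icc 0 N, (∀ t ∈ Icc 0 S, |u t| ≤ η) → |u S| ≤ η / 2) :
    ∀ t ∈ Icc 0 N, |u t| ≤ η := by
  refine IsClosed.Icc_subset_of_forall_mem_nhdsGT_of_Icc_subset (s := {t | |u t| ≤ η})
    ((isClosed_le hu.abs continuous_const).inter isClosed_Icc) h0 fun t ht hs => ?_
  have := h t ⟨ht.1, ht.2.le⟩ hs
  refine nhdsWithin_le_nhds ?_
  filter_upwards [hu.abs.continuousAt.eventually (gt_mem_nhds (show |u t| < η by linarith))]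
    with r hr using hr.le

namespace IsIsochronousSolution

variable {f u : ℝ → ℝ} {M ω η : ℝ}

lemma abs_le_half (h : IsIsochronousSolution f M ω η u)
    (hsmall : Real.exp (M * (2 * π / ω)) * ‖phasePoint f ω u 0‖ ≤ η / 2) {t : ℝ} (ht : 0 ≤ t)
    (hu : ∀ r ∈ Icc 0 t, |u r| ≤ η) (hL : logGrowth f u t ≤ M * (2 * π / ω)) :
    |u t| ≤ η / 2 := by
  have h1 := Complex.abs_re_le_norm (phasePoint f ω u t)
  rw [phasePoint_re, h.norm_phasePoint_eq ht hu, logGrowth_zero, sub_zero] at h1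
  refine h1.trans (le_trans ?_ hsmall)
  gcongr

lemma abs_zero_le (h : IsIsochronousSolution f M ω η u) (hη : 0 < η)
    (hsmall : Real.exp (M * (2 * π / ω)) * ‖phasePoint f ω u 0‖ ≤ η / 2) : |u 0| ≤ η := by
  have hω := h.frequency_pos
  have hM := h.damping_bound_nonneg
  have h1 := Complex.abs_re_le_norm (phasePoint f ω u 0)
  have h2 : 1 ≤ Real.exp (M * (2 * π / ω)) := Real.one_le_exp (by positivity)
  rw [phasePoint_re] at h1
  nlinarith [norm_nonneg (phasePoint f ω u 0)]

lemma abs_le_of_le_period (h : IsIsochronousSolution f M ω η u) (hη : 0 < η)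
    (hsmall : Real.exp (M * (2 * π / ω)) * ‖phasePoint f ω u 0‖ ≤ η / 2) :
    ∀ t ∈ Icc 0 (2 * π / ω), |u t| ≤ η :=
  abs_le_of_bootstrap h.contDiff.continuous hη (h.abs_zero_le hη hsmall) fun _ hS hu =>
    h.abs_le_half hsmall hS.1 hu
      ((h.logGrowth_le hS.1).trans (mul_le_mul_of_nonneg_left hS.2 h.damping_bound_nonneg))

lemma abs_le_of_nonneg (h : IsIsochronousSolution f M ω η u) (hη : 0 < η)
    (hsmall : Real.exp (M * (2 * π / ω)) * ‖phasePoint f ω u 0‖ ≤ η / 2)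
    (h0 : phasePoint f ω u 0 ≠ 0) (hL : logGrowth f u (2 * π / ω) ≤ 0) {t : ℝ} (ht : 0 ≤ t) :
    |u t| ≤ η := by
  have hω := h.frequency_pos
  have hM := h.damping_bound_nonneg
  have hτ : 0 < 2 * π / ω := by positivity
  refine abs_le_of_bootstrap h.contDiff.continuous hη (h.abs_zero_le hη hsmall) (N := t)
    (fun S hS hu => h.abs_le_half hsmall hS.1 hu ?_) t ⟨ht, le_rfl⟩
  have claim : ∀ n : ℕ, ∀ r ∈ Icc 0 S, r ≤ n * (2 * π / ω) →
      logGrowth f u r ≤ M * (2 * π / ω) := by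
    intro n
    induction n with
    | zero =>
      intro r hr hrn
      have : r = 0 := le_antisymm (by simpa using hrn) hr.1
      rw [this, logGrowth_zero]
      positivity
    | succ n ih =>
      intro r hr hrn
      rcases le_total r (2 * π / ω) with hle | hle
      · exact (h.logGrowth_le hr.1).trans (mul_le_mul_of_nonneg_left hle hM)
      · have h1 := h.logGrowth_add_period_le h0 hL (sub_nonneg.2 hle)
          (fun q hq => hu q ⟨hq.1, by linarith [hq.2, hr.2]⟩)
        rw [sub_add_cancel] at h1
        refine h1.trans (ih _ ⟨sub_nonneg.2 hle, by linarith [hr.2]⟩ ?_)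
        push_cast at hrn
        linarith
  obtain ⟨n, hn⟩ := exists_nat_ge (S / (2 * π / ω))
  exact claim n S ⟨hS.1, le_rfl⟩ ((div_le_iff₀ hτ).1 hn)

/-- A periodic orbit that does not grow over one turn closes up after exactly one turn. -/
lemma minimal_period_eq_of_logGrowth_nonpos (h : IsIsochronousSolution f M ω η u) (hη : 0 < η)
    (hsmall : Real.exp (M * (2 * π / ω)) * ‖phasePoint f ω u 0‖ ≤ η / 2)
    (h0 : phasePoint f ω u 0 ≠ 0) (hL : logGrowth f u (2 * π / ω) ≤ 0) {p : ℝ}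
    (hp : IsLeast {p : ℝ | 0 < p ∧ ∀ t, u (t + p) = u t} p) : p = 2 * π / ω := by
  have hω := h.frequency_pos
  have hτ : 0 < 2 * π / ω := by positivity
  have hu : ∀ t, 0 ≤ t → |u t| ≤ η := fun t ht => h.abs_le_of_nonneg hη hsmall h0 hL ht
  obtain ⟨hp0, hper⟩ := hp.1
  have hfun : (fun t => u (t + p)) = u := funext hper
  have hdp : deriv u p = deriv u 0 := by
    have := congrFun (congrArg deriv hfun) 0
    rwa [deriv_comp_add_const, zero_add] at this
  have hup : u p = u 0 := by simpa using hper 0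
  have hzp : phasePoint f ω u p = phasePoint f ω u 0 := by
    rw [phasePoint, hup, hdp, phasePoint]
  have hLp : logGrowth f u p = 0 := by
    have := h.norm_phasePoint_eq hp0.le fun r hr => hu r hr.1
    rw [hzp, eq_comm, mul_eq_right₀ (norm_ne_zero_iff.2 h0), Real.exp_eq_one_iff] at this
    simpa using this
  obtain ⟨k, hk⟩ : ∃ k : ℕ, p = (k + 1) * (2 * π / ω) := by
    have := h.phasePoint_eq hp0.le fun r hr => hu r hr.1
    rw [hzp, hLp, logGrowth_zero, sub_zero, Real.exp_zero, Complex.ofReal_one, one_mul, eq_comm,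
      mul_eq_right₀ h0, Complex.exp_eq_one_iff] at this
    obtain ⟨n, hn⟩ := this
    have hn' : -(ω * p) = n * (2 * π) := by
      have := congrArg Complex.im hn
      simpa using this
    have hneg : n < 0 := by
      have : (n : ℝ) < 0 := by
        have : 0 < ω * p := by positivity
        nlinarith [pi_pos]
      exact_mod_cast this
    obtain ⟨k, hk⟩ : ∃ k : ℕ, -n = k + 1 := ⟨(-n - 1).toNat, by omega⟩
    refine ⟨k, ?_⟩
    have hk' : -(n : ℝ) = k + 1 := by exact_mod_cast hk
    rw [← hk']
    field_simp
    linarith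
  have hstep : ∀ t, 0 ≤ t → logGrowth f u (t + 2 * π / ω) ≤ logGrowth f u t := fun t ht =>
    h.logGrowth_add_period_le h0 hL ht fun r hr => hu r hr.1
  have hmono : ∀ n : ℕ, logGrowth f u ((n + 1) * (2 * π / ω)) ≤ logGrowth f u (2 * π / ω) := by
    intro n
    induction n with
    | zero => simp
    | succ n ih =>
      refine le_trans ?_ ih
      have := hstep ((n + 1) * (2 * π / ω)) (by positivity)
      rw [show ((n + 1 : ℕ) + 1 : ℝ) * (2 * π / ω) = (n + 1) * (2 * π / ω) + 2 * π / ω by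
        push_cast; ring]
      exact this
  have hLτ : logGrowth f u (2 * π / ω) = 0 := by
    refine le_antisymm hL ?_
    have := hmono k
    rwa [← hk, hLp] at this
  have hpos : ∀ t, 0 ≤ t → u (t + 2 * π / ω) = u t := fun t ht =>
    (h.eq_add_period_of_logGrowth_eq ht (fun r hr => hu r hr.1)
      (h.phasePoint_ne_zero ht (fun r hr => hu r hr.1) h0) (by simpa using hLτ)).1
  have hall : ∀ t, u (t + 2 * π / ω) = u t := by
    intro t
    obtain ⟨n, hn⟩ := exists_nat_ge (-t / p)
    have hper' : Function.Periodic u (n * p) := Function.Periodic.nat_mul hper n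
    have h1 := hpos (t + n * p) (by linarith [(div_le_iff₀ hp0).1 hn])
    rw [hper' t, add_right_comm, hper'] at h1
    exact h1
  refine le_antisymm (hp.2 ⟨hτ, hall⟩) ?_
  rw [hk]
  nlinarith [mul_nonneg k.cast_nonneg hτ.le]

/-- Time reversal. -/
lemma reverse (h : IsIsochronousSolution f M ω η u) :
    IsIsochronousSolution (fun x => -f x) M ω η (fun t => u (-t)) where
  continuous_damping := h.continuous_damping.neg
  abs_damping_le x := by simpa using h.abs_damping_le x
  damping_zero := by simpa using h.damping_zero
  frequency_pos := h.frequency_pos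
  contDiff := h.contDiff.comp contDiff_neg
  eq t ht := by
    have hd : deriv (fun t => u (-t)) = fun t => -deriv u (-t) := by
      ext t
      rw [deriv_comp_neg]
    have := h.eq (-t) ht
    rw [hd, deriv.fun_neg, deriv_comp_neg, averagedDamping_neg]
    linarith

lemma logGrowth_reverse (f u : ℝ → ℝ) (t : ℝ) :
    logGrowth (fun x => -f x) (fun t => u (-t)) t = logGrowth f u (-t) := by
  have h1 : ∀ s, averagedDamping (fun x => -f x) (u (-s)) = -averagedDamping f (u (-s)) :=
    fun s => averagedDamping_neg f _
  simp only [logGrowth, h1, intervalIntegral.integral_neg, neg_neg]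
  rw [intervalIntegral.integral_comp_neg (fun s => averagedDamping f (u s)), neg_zero,
    intervalIntegral.integral_symm]

lemma norm_phasePoint_reverse_zero (f u : ℝ → ℝ) (ω : ℝ) :
    ‖phasePoint (fun x => -f x) ω (fun t => u (-t)) 0‖ = ‖phasePoint f ω u 0‖ := by
  have hd : deriv (fun t => u (-t)) 0 = -deriv u 0 := by rw [deriv_comp_neg, neg_zero]
  rw [← Complex.norm_conj]
  congr 1
  apply Complex.ext
  · simp
  · simp only [Complex.conj_im, phasePoint_im, hd, averagedDamping_neg, neg_zero]
    ring

theorem minimal_period_eq (h : IsIsochronousSolution f M ω η u) (hη : 0 < η)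
    (hsmall : Real.exp (M * (2 * π / ω)) * ‖phasePoint f ω u 0‖ ≤ η / 2)
    (h0 : phasePoint f ω u 0 ≠ 0) {p : ℝ}
    (hp : IsLeast {p : ℝ | 0 < p ∧ ∀ t, u (t + p) = u t} p) : p = 2 * π / ω := by
  have hω := h.frequency_pos
  have hτ : 0 < 2 * π / ω := by positivity
  have hsmall' := hsmall
  rw [← norm_phasePoint_reverse_zero] at hsmall'
  rcases le_or_gt (logGrowth f u (2 * π / ω)) 0 with hL | hL
  · exact h.minimal_period_eq_of_logGrowth_nonpos hη hsmall h0 hL hp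
  rcases le_or_gt (logGrowth f u (-(2 * π / ω))) 0 with hL' | hL'
  · refine h.reverse.minimal_period_eq_of_logGrowth_nonpos hη hsmall' ?_
      (by rwa [logGrowth_reverse]) ?_
    · rwa [← norm_ne_zero_iff, norm_phasePoint_reverse_zero, norm_ne_zero_iff]
    · convert hp using 4 with q
      constructor
      · intro hq t
        have := hq (-t - q)
        rw [show -(-t - q + q) = t by ring, show -(-t - q) = t + q by ring] at this
        exact this.symm
      · intro hq t
        have := hq (-(t + q))
        rw [show -(t + q) + q = -t by ring] at this
        exact this.symm
  · exfalso
    have hu : ∀ r ∈ Icc (-(2 * π / ω)) (2 * π / ω), |u r| ≤ η := by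
      intro r hr
      rcases le_total 0 r with hr0 | hr0
      · exact h.abs_le_of_le_period hη hsmall r ⟨hr0, hr.2⟩
      · simpa using h.reverse.abs_le_of_le_period hη hsmall' (-r)
          ⟨by linarith, by linarith [hr.1]⟩
    have hc : ContinuousOn (fun s => logGrowth f u (s + 2 * π / ω) - logGrowth f u s)
        (Icc (-(2 * π / ω)) 0) :=
      ((h.continuous_logGrowth.comp (continuous_add_const _)).sub
        h.continuous_logGrowth).continuousOn
    obtain ⟨s, hs, hs0⟩ := intermediate_value_Icc (by linarith) hc
      (show (0:ℝ) ∈ Icc _ _ from ⟨by simpa using hL'.le, by simpa using hL.le⟩)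
    have := (h.eq_add_period_of_logGrowth_eq hs.2
      (fun r hr => hu r ⟨hs.1.trans hr.1, by simpa using hr.2⟩) h0 (sub_eq_zero.1 hs0)).2
    rw [zero_add, logGrowth_zero] at this
    exact hL.ne' this

end IsIsochronousSolution

lemma contDiffOn_averagedDamping {f : ℝ → ℝ} (hf : Continuous f) {s : Set ℝ} (hs : IsOpen s)
    (hfs : ContDiffOn ℝ 1 f s) : ContDiffOn ℝ 2 (averagedDamping f) (s \ {0}) := by
  have hc : Continuous fun x => x * f x := by fun_prop
  have hI : ∀ x, HasDerivAt (fun x => ∫ r in (0:ℝ)..x, r * f r) (x * f x) x := fun x =>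
    (hc.integral_hasStrictDerivAt 0 x).hasDerivAt
  have h2 : ContDiffOn ℝ 2 (fun x => ∫ r in (0:ℝ)..x, r * f r) s := by
    refine (contDiffOn_succ_iff_deriv_of_isOpen (n := 1) hs).2
      ⟨fun x _ => (hI x).differentiableAt.differentiableWithinAt, by simp, ?_⟩
    rw [show deriv (fun x => ∫ r in (0:ℝ)..x, r * f r) = fun x => x * f x from
      funext fun x => (hI x).deriv]
    exact contDiffOn_id.mul hfs
  exact (h2.mono sdiff_subset).div (contDiffOn_id.pow 2) fun x hx => pow_ne_zero 2 hx.2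

lemma norm_phasePoint_zero_le {f u : ℝ → ℝ} {M ω η c : ℝ} (h : IsIsochronousSolution f M ω η u)
    (hc : 0 ≤ c) (hu : u 0 = c) (hu' : deriv u 0 = 0) :
    ‖phasePoint f ω u 0‖ ≤ c * (1 + M / ω) := by
  have hω := h.frequency_pos
  refine (Complex.norm_le_abs_re_add_abs_im _).trans ?_
  rw [phasePoint_re, phasePoint_im, hu, hu', zero_add, abs_div, abs_mul, abs_of_nonneg hc,
    abs_of_pos hω, mul_add, mul_one, ← mul_div_assoc]
  gcongr
  exact h.abs_averagedDamping_le c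

/-- Suppose `g''(0) = f''(0) = 0` and the origin is a center of the Liénard equation with
period function `T`. Let `C(x) = g(x)/g'(0) − (1/(g'(0)x³))(∫₀ˣ s f(s) ds)²`. If `C'' ≡ 0`
on an interval `J = (a₂,b₂) ∋ 0`, then `T` is constant near `0` (the center is isochronous). -/
theorem lienard_isochronous_of_C_second_deriv_zero
    (a b : ℝ) (ha : a < 0) (hb : 0 < b) (f g : ℝ → ℝ)
    (hf : ContDiffOn ℝ 2 f (Icc a b)) (hg : ContDiffOn ℝ 3 g (Icc a b))
    (hf0 : f 0 = 0) (hg0 : g 0 = 0) (hg'0 : 0 < deriv g 0)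
    (hg''0 : iteratedDeriv 2 g 0 = 0) (hf''0 : iteratedDeriv 2 f 0 = 0)
    (δ : ℝ) (hδ : 0 < δ) (T : ℝ → ℝ)
    (hsol : ∀ c ∈ Ioo (0:ℝ) δ, ∃ u, IsLienardSolution f g u ∧ u 0 = c ∧ deriv u 0 = 0)
    (hcenter : ∀ c ∈ Ioo (0:ℝ) δ, ∀ u, IsLienardSolution f g u → u 0 = c → deriv u 0 = 0 →
      ∃ p > 0, ∀ t, u (t + p) = u t)
    (hT : ∀ c ∈ Ioo (0:ℝ) δ, ∀ u, IsLienardSolution f g u → u 0 = c → deriv u 0 = 0 →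
      IsLeast {p : ℝ | 0 < p ∧ ∀ t, u (t + p) = u t} (T c))
    (C : ℝ → ℝ)
    (hC : ∀ x : ℝ, x ≠ 0 →
      C x = g x / deriv g 0 - (1 / (deriv g 0 * x ^ 3)) * (∫ s in (0:ℝ)..x, s * f s) ^ 2)
    (hC0 : C 0 = 0)
    (a₂ b₂ : ℝ) (ha₂ : a₂ < 0) (hb₂ : 0 < b₂)
    (hC'' : ∀ x ∈ Ioo a₂ b₂, deriv (deriv C) x = 0) :
    ∃ ε, 0 < ε ∧ ε ≤ δ ∧ ∀ c ∈ Ioo (0:ℝ) ε, ∀ c' ∈ Ioo (0:ℝ) ε, T c = T c' := by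
  have hη₁ : ∃ η, 0 < η ∧ a < -η ∧ η < b ∧ a₂ < -η ∧ η < b₂ := by
    refine ⟨min (min (-a) b) (min (-a₂) b₂) / 2, ?_⟩
    have hpos : 0 < min (min (-a) b) (min (-a₂) b₂) := by
      simp only [lt_min_iff]
      exact ⟨⟨by linarith, hb⟩, by linarith, hb₂⟩
    have h1 := (min_le_left (min (-a) b) (min (-a₂) b₂))
    have h2 := (min_le_right (min (-a) b) (min (-a₂) b₂))
    have h3 := h1.trans (min_le_left _ _)
    have h4 := h1.trans (min_le_right _ _)
    have h5 := h2.trans (min_le_left _ _)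
    have h6 := h2.trans (min_le_right _ _)
    refine ⟨by linarith, by linarith, by linarith, by linarith, by linarith⟩
  obtain ⟨η, hη, haη, hηb, ha₂η, hηb₂⟩ := hη₁
  have hsub : Icc (-η) η ⊆ Icc a b := Icc_subset_Icc haη.le hηb.le
  have hfc : ContinuousOn f (Icc (-η) η) := hf.continuousOn.mono hsub
  set F : ℝ → ℝ := fun x => f (max (-η) (min η x)) with hF
  have hclamp : ∀ x, max (-η) (min η x) ∈ Icc (-η) η := fun x =>
    ⟨le_max_left _ _, max_le (by linarith) (min_le_left _ _)⟩
  have hFc : Continuous F := hfc.comp_continuous (by fun_prop) hclamp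
  have hFf : ∀ x ∈ Icc (-η) η, F x = f x := fun x hx => by
    simp only [hF, min_eq_right hx.2, max_eq_right hx.1]
  have hF0 : F 0 = 0 := by rw [hFf 0 ⟨by linarith, hη.le⟩, hf0]
  obtain ⟨M, hM⟩ : ∃ M, ∀ x, |F x| ≤ M := by
    obtain ⟨M, hM⟩ := isCompact_Icc.exists_bound_of_continuousOn hfc
    exact ⟨M, fun x => hM _ (hclamp x)⟩
  have hM0 : 0 ≤ M := (abs_nonneg _).trans (hM 0)
  set ω := √(deriv g 0) with hω
  have hω0 : 0 < ω := Real.sqrt_pos.2 hg'0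
  have hω2 : deriv g 0 = ω ^ 2 := (Real.sq_sqrt hg'0.le).symm
  have hCeq : ∀ x ∈ Icc (-η) η,
      C x = g x / ω ^ 2 - x * averagedDamping F x ^ 2 / ω ^ 2 := by
    intro x hx
    rcases eq_or_ne x 0 with rfl | hx0
    · simp [hC0, hg0]
    have hint : ∫ s in (0:ℝ)..x, s * f s = ∫ s in (0:ℝ)..x, s * F s := by
      refine intervalIntegral.integral_congr fun s hs => ?_
      have hs' : s ∈ Icc (-η) η :=
        (convex_Icc (-η) η).ordConnected.uIcc_subset ⟨by linarith, hη.le⟩ hx hs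
      simp only [hFf s hs']
    rw [hC x hx0, hω2, hint, averagedDamping]
    field_simp
  have hIoo : Ioo (-η) η ⊆ Icc (-η) η := Ioo_subset_Icc_self
  have hgd : HasDerivAt g (ω ^ 2) 0 := by
    rw [← hω2]
    exact ((hg.contDiffAt (Icc_mem_nhds ha hb)).differentiableAt (by norm_num)).hasDerivAt
  have hCd : HasDerivAt C 1 0 := by
    have h1 := (hgd.div_const (ω ^ 2)).sub
      ((hasDerivAt_mul_averagedDamping_sq hFc hF0 0).div_const (ω ^ 2))
    refine (h1.congr_of_eventuallyEq ?_).congr_deriv ?_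
    · filter_upwards [Ioo_mem_nhds (neg_lt_zero.2 hη) hη] with x hx using hCeq x (hIoo hx)
    · rw [averagedDamping_zero, zero_mul, zero_div, sub_zero, div_self (by positivity)]
  have hCs : ContDiffOn ℝ 2 C (Ioo (-η) η \ {0}) := by
    have hF1 : ContDiffOn ℝ 1 F (Ioo (-η) η) :=
      ((hf.of_le (by norm_num)).mono (hIoo.trans hsub)).congr fun x hx => hFf x (hIoo hx)
    have hg2 : ContDiffOn ℝ 2 g (Ioo (-η) η \ {0}) :=
      (hg.of_le (by norm_num)).mono (sdiff_subset.trans (hIoo.trans hsub))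
    refine ContDiffOn.congr (f := fun x => g x / ω ^ 2 - x * averagedDamping F x ^ 2 / ω ^ 2) ?_
      fun x hx => hCeq x (hIoo hx.1)
    exact (hg2.div_const _).sub
      ((contDiffOn_id.mul ((contDiffOn_averagedDamping hFc isOpen_Ioo hF1).pow 2)).div_const _)
  have hCx : ∀ x ∈ Ioo (-η) η, C x = x := eq_self_of_deriv_deriv_eq_zero hC0 hCd hCs
    fun x hx => hC'' x ⟨by linarith [hx.1], by linarith [hx.2]⟩
  have hgx : ∀ x ∈ Ioo (-η) η, g x = ω ^ 2 * x + x * averagedDamping F x ^ 2 := by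
    intro x hx
    have h1 := hCeq x (hIoo hx)
    rw [hCx x hx] at h1
    field_simp at h1
    linarith
  have hE : 0 < 2 * Real.exp (M * (2 * π / ω)) * (1 + M / ω) := by positivity
  set ε := min δ (η / 2 / (2 * Real.exp (M * (2 * π / ω)) * (1 + M / ω))) with hε
  have key : ∀ c ∈ Ioo (0:ℝ) ε, T c = 2 * π / ω := by
    intro c hc
    have hcδ : c ∈ Ioo 0 δ := ⟨hc.1, hc.2.trans_le (min_le_left _ _)⟩
    have hcε : c * (2 * Real.exp (M * (2 * π / ω)) * (1 + M / ω)) < η / 2 :=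
      (lt_div_iff₀ hE).1 (hc.2.trans_le (min_le_right _ _))
    obtain ⟨u, hu, hu0, hu'0⟩ := hsol c hcδ
    have hsys : IsIsochronousSolution F M ω (η / 2) u :=
      { continuous_damping := hFc
        abs_damping_le := hM
        damping_zero := hF0
        frequency_pos := hω0
        contDiff := hu.1
        eq := fun t ht => by
          have hm : u t ∈ Ioo (-η) η := abs_lt.1 (ht.trans_lt (half_lt_self hη))
          rw [hFf _ (hIoo hm), ← hgx _ hm]
          exact hu.2 t }
    refine hsys.minimal_period_eq (half_pos hη) ?_ ?_ (hT c hcδ u hu hu0 hu'0)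
    · have h1 := mul_le_mul_of_nonneg_left (norm_phasePoint_zero_le hsys hc.1.le hu0 hu'0)
        (Real.exp_pos (M * (2 * π / ω))).le
      linarith
    · intro h0
      have := congrArg Complex.re h0
      rw [phasePoint_re, hu0, Complex.zero_re] at this
      exact hc.1.ne' this
  exact ⟨ε, lt_min hδ (by positivity), min_le_left _ _, fun c hc c' hc' => by
    rw [key c hc, key c' hc']⟩
end

section
/- Let f, g : ℝ → ℝ be C³ on an interval (a,b) containing 0, with f(0) = g(0) = 0, g'(0) > 0, g''(0) = 0 and f''(0) = 0, and suppose the origin is a center of x'' + f(x)x' + g(x) = 0 with period function T. Let C(x) = g(x)/g'(0) − (1/(g'(0)·x³))·(∫₀ˣ s·f(s) ds)² for x ≠ 0, C(0) = 0, let gₙ(x) = g(x)/g'(0) − x, F(x) = ∫₀ˣ s·f(s) ds, and σ(x) = (2/g'(0))·x²·f(x)·F(x) − (4/g'(0))·F(x)² + x³·gₙ(x) − x⁴·gₙ'(x). Assume x·C(x) > 0 for all x ≠ 0 in a punctured neighborhood J of 0. Then: (1) if σ(x) ≤ 0 for all x ∈ J, T is decreasing on some interval (0,ε); (2) if σ(x)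 ≥ 0 for all x ∈ J, T is increasing on some interval (0,ε); (3) if σ(x) = 0 for all x ∈ J, T is constant on some interval (0,ε). -/
open Set Real

/-- Bounds and Lipschitz estimates for the coefficients of the planar system
`x' = ω y - x B(x)`, `y' = -ω x h(x) - y B(x)`. -/
structure PlanarBounds (ω L : ℝ) (B h : ℝ → ℝ) : Prop where
  ω_pos : 0 < ω
  lipB : ∀ x y, |B x - B y| ≤ L * |x - y|
  liph : ∀ x y, |h x - h y| ≤ L * |x - y|
  bddB : ∀ x, |B x| ≤ ω / 2
  bddh : ∀ x, |h x - 1| ≤ 1 / 2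

/-- `(x, y)` satisfies the planar system at all times in `S`. -/
structure IsPlanarSolutionOn (ω : ℝ) (B h : ℝ → ℝ) (S : Set ℝ) (x y : ℝ → ℝ) : Prop where
  cont_x : Continuous x
  cont_y : Continuous y
  deriv_x : ∀ t ∈ S, HasDerivAt x (ω * y t - x t * B (x t)) t
  deriv_y : ∀ t ∈ S, HasDerivAt y (-(ω * x t * h (x t)) - y t * B (x t)) t

/-- Clockwise angular speed of the planar system at log-radius `l` and angle `s`. -/
noncomputable def angularSpeed (ω : ℝ) (h : ℝ → ℝ) (l s : ℝ) : ℝ :=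
  ω * (sin s ^ 2 + cos s ^ 2 * h (exp l * cos s))

/-- Time derivative of the log-radius at log-radius `l` and angle `s`. -/
noncomputable def radialSpeed (ω : ℝ) (B h : ℝ → ℝ) (l s : ℝ) : ℝ :=
  ω * cos s * sin s * (1 - h (exp l * cos s)) - B (exp l * cos s)

/-- Angular derivative of the log-radius at log-radius `l` and angle `s`. -/
noncomputable def polarField (ω : ℝ) (B h : ℝ → ℝ) (l s : ℝ) : ℝ :=
  -(radialSpeed ω B h l s / angularSpeed ω h l s)

/-- The log-radius `l` and the time `τ` as functions of the angle, along a solution of the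
planar system on `S`. -/
structure IsPolarRep (ω : ℝ) (B h : ℝ → ℝ) (S : Set ℝ) (x y l τ : ℝ → ℝ) : Prop where
  anti : StrictAnti τ
  surj : Function.Surjective τ
  lip : ∀ s s', |l s - l s'| ≤ 2 * |s - s'|
  x_eq : ∀ s, τ s ∈ S → x (τ s) = exp (l s) * cos s
  y_eq : ∀ s, τ s ∈ S → y (τ s) = exp (l s) * sin s
  deriv_l : ∀ s, τ s ∈ S → HasDerivAt l (polarField ω B h (l s) s) s
  deriv_τ : ∀ s, τ s ∈ S → HasDerivAt τ (-(angularSpeed ω h (l s) s)⁻¹) s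

theorem eq_zero_of_abs_deriv_le {S : Set ℝ} (hS : S.OrdConnected) {E E' : ℝ → ℝ} {k : ℝ}
    (hE : ∀ t ∈ S, HasDerivAt E (E' t) t) (hE0 : ∀ t ∈ S, 0 ≤ E t)
    (hk : ∀ t ∈ S, |E' t| ≤ k * E t) {s t : ℝ} (hs : s ∈ S) (ht : t ∈ S) (h0 : E s = 0) :
    E t = 0 := by
  refine le_antisymm ?_ (hE0 t ht)
  rcases le_total s t with hst | hst
  · have hsub : Icc s t ⊆ S := hS.out hs ht
    have hd : ∀ r ∈ Icc s t, HasDerivAt (fun r => E r * exp (-k * r))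
        (E' r * exp (-k * r) + E r * (exp (-k * r) * (-k * 1))) r := fun r hr =>
      (hE r (hsub hr)).mul ((((hasDerivAt_id r).const_mul (-k))).exp)
    have hanti : AntitoneOn (fun r => E r * exp (-k * r)) (Icc s t) := by
      refine antitoneOn_of_deriv_nonpos (convex_Icc s t)
        (fun r hr => (hd r hr).continuousAt.continuousWithinAt)
        (fun r hr => (hd r (interior_subset hr)).differentiableAt.differentiableWithinAt) ?_
      intro r hr
      have hr' := interior_subset hr
      rw [(hd r hr').deriv]
      have h1 := (abs_le.1 (hk r (hsub hr'))).2
      have h2 := exp_pos (-k * r)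
      nlinarith
    have := hanti (left_mem_Icc.2 hst) (right_mem_Icc.2 hst) hst
    simp only [h0, zero_mul] at this
    exact nonpos_of_mul_nonpos_left this (exp_pos _)
  · have hsub : Icc t s ⊆ S := hS.out ht hs
    have hd : ∀ r ∈ Icc t s, HasDerivAt (fun r => E r * exp (k * r))
        (E' r * exp (k * r) + E r * (exp (k * r) * (k * 1))) r := fun r hr =>
      (hE r (hsub hr)).mul ((((hasDerivAt_id r).const_mul k)).exp)
    have hmono : MonotoneOn (fun r => E r * exp (k * r)) (Icc t s) := by
      refine monotoneOn_of_deriv_nonneg (convex_Icc t s)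
        (fun r hr => (hd r hr).continuousAt.continuousWithinAt)
        (fun r hr => (hd r (interior_subset hr)).differentiableAt.differentiableWithinAt) ?_
      intro r hr
      have hr' := interior_subset hr
      rw [(hd r hr').deriv]
      have h1 := (abs_le.1 (hk r (hsub hr'))).1
      have h2 := exp_pos (k * r)
      nlinarith
    have := hmono (left_mem_Icc.2 hst) (right_mem_Icc.2 hst) hst
    simp only [h0, zero_mul] at this
    exact nonpos_of_mul_nonpos_left this (exp_pos _)

/-- Solutions of a scalar differential inequality `|D'| ≤ K |D|` keep their sign. -/
theorem nonneg_of_abs_deriv_le {S : Set ℝ} (hS : S.OrdConnected) {D D' : ℝ → ℝ} {K : ℝ}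
    (hD : ∀ t ∈ S, HasDerivAt D (D' t) t) (hK : ∀ t ∈ S, |D' t| ≤ K * |D t|)
    {s t : ℝ} (hs : s ∈ S) (ht : t ∈ S) (h0 : 0 ≤ D s) : 0 ≤ D t := by
  by_contra! hneg
  have hsub : uIcc s t ⊆ S := hS.uIcc_subset hs ht
  have hc : ContinuousOn D (uIcc s t) := fun r hr =>
    (hD r (hsub hr)).continuousAt.continuousWithinAt
  obtain ⟨r, hr, hr0⟩ : (0 : ℝ) ∈ D '' uIcc s t :=
    intermediate_value_uIcc hc (mem_uIcc.2 (Or.inr ⟨hneg.le, h0⟩))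
  have := eq_zero_of_abs_deriv_le (E := fun t => D t ^ 2) (E' := fun t => 2 * D t * D' t)
    (k := 2 * K) hS (fun t ht => by simpa using (hD t ht).fun_pow 2) (fun t _ => sq_nonneg _)
    (fun t ht => by
      rw [abs_mul, abs_mul, abs_two, ← sq_abs (D t)]
      nlinarith [mul_le_mul_of_nonneg_left (hK t ht) (abs_nonneg (D t))])
    (hsub hr) ht (by simp [hr0])
  exact hneg.ne (by simpa using this)

namespace PlanarBounds

variable {ω L : ℝ} {B h : ℝ → ℝ}

theorem h_mem (H : PlanarBounds ω L B h) (x : ℝ) : 1 / 2 ≤ h x ∧ h x ≤ 3 / 2 := by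
  have := abs_le.1 (H.bddh x)
  constructor <;> linarith

theorem L_nonneg (H : PlanarBounds ω L B h) : 0 ≤ L := by
  simpa using (abs_nonneg _).trans (H.lipB 1 0)

theorem le_angularSpeed (H : PlanarBounds ω L B h) (l s : ℝ) :
    ω / 2 ≤ angularSpeed ω h l s := by
  unfold angularSpeed
  have h1 := H.h_mem (exp l * cos s)
  have h2 := sin_sq_add_cos_sq s
  have h3 : 1 / 2 ≤ sin s ^ 2 + cos s ^ 2 * h (exp l * cos s) := by
    nlinarith [mul_le_mul_of_nonneg_left h1.1 (sq_nonneg (cos s)), sq_nonneg (sin s)]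
  nlinarith [mul_le_mul_of_nonneg_left h3 H.ω_pos.le]

theorem angularSpeed_pos (H : PlanarBounds ω L B h) (l s : ℝ) : 0 < angularSpeed ω h l s :=
  (half_pos H.ω_pos).trans_le (H.le_angularSpeed l s)

theorem abs_radialSpeed_le (H : PlanarBounds ω L B h) (l s : ℝ) :
    |radialSpeed ω B h l s| ≤ ω := by
  unfold radialSpeed
  have h1 := abs_le.1 (H.bddh (exp l * cos s))
  have h2 := H.bddB (exp l * cos s)
  have h3 : |cos s * sin s * (1 - h (exp l * cos s))| ≤ 1 / 2 := by
    rw [abs_mul, abs_mul, abs_sub_comm]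
    have := mul_le_mul (mul_le_mul (abs_cos_le_one s) (abs_sin_le_one s) (abs_nonneg _) one_pos.le)
      (H.bddh (exp l * cos s)) (abs_nonneg _) (by norm_num)
    simpa using this
  calc _ ≤ |ω * cos s * sin s * (1 - h (exp l * cos s))| + |B (exp l * cos s)| := abs_sub _ _
    _ = ω * |cos s * sin s * (1 - h (exp l * cos s))| + |B (exp l * cos s)| := by
      rw [mul_assoc, mul_assoc, abs_mul, abs_of_pos H.ω_pos, mul_assoc]
    _ ≤ ω := by nlinarith [H.ω_pos]

theorem abs_polarField_le (H : PlanarBounds ω L B h) (l s : ℝ) :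
    |polarField ω B h l s| ≤ 2 := by
  unfold polarField
  rw [abs_neg, abs_div, abs_of_pos (H.angularSpeed_pos l s), div_le_iff₀ (H.angularSpeed_pos l s)]
  linarith [H.abs_radialSpeed_le l s, H.le_angularSpeed l s]

theorem abs_polarField_sub_le (H : PlanarBounds ω L B h) {l l' : ℝ} (hl : l ≤ 0) (hl' : l' ≤ 0)
    (s : ℝ) : |polarField ω B h l s - polarField ω B h l' s| ≤
      2 * (3 * ω + 1) * L / ω * |l - l'| := by
  have hω := H.ω_pos
  have hexp : |exp l - exp l'| ≤ |l - l'| := by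
    have := Convex.norm_image_sub_le_of_norm_hasDerivWithin_le (f := exp) (f' := exp)
      (s := Iic (0 : ℝ)) (C := 1) (fun x _ => (Real.hasDerivAt_exp x).hasDerivWithinAt)
      (fun x hx => by simpa using hx) (convex_Iic 0) hl' hl
    simpa using this
  have hx : |exp l * cos s - exp l' * cos s| ≤ |l - l'| := by
    rw [← sub_mul, abs_mul]
    nlinarith [abs_cos_le_one s, abs_nonneg (exp l - exp l'), abs_nonneg (cos s)]
  set x := exp l * cos s with hxdef
  set x' := exp l' * cos s with hxdef'
  set d := |l - l'| with hd
  have hL := H.L_nonneg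
  have hB : |B x - B x'| ≤ L * d := (H.lipB x x').trans (by gcongr)
  have hh : |h x - h x'| ≤ L * d := (H.liph x x').trans (by gcongr)
  have hP : |radialSpeed ω B h l s - radialSpeed ω B h l' s| ≤ (ω + 1) * L * d := by
    have e : radialSpeed ω B h l s - radialSpeed ω B h l' s =
        -(ω * (cos s * sin s * (h x - h x'))) - (B x - B x') := by
      simp only [radialSpeed, ← hxdef, ← hxdef']; ring
    have h3 : |cos s * sin s * (h x - h x')| ≤ L * d := by
      rw [abs_mul, abs_mul]
      have := mul_le_mul (mul_le_mul (abs_cos_le_one s) (abs_sin_le_one s) (abs_nonneg _)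
        one_pos.le) hh (abs_nonneg _) (by norm_num)
      simpa using this
    rw [e]
    refine (abs_sub _ _).trans ?_
    rw [abs_neg, abs_mul, abs_of_pos hω]
    nlinarith
  have hΩ : |angularSpeed ω h l' s - angularSpeed ω h l s| ≤ ω * L * d := by
    have e : angularSpeed ω h l' s - angularSpeed ω h l s =
        -(ω * (cos s ^ 2 * (h x - h x'))) := by
      simp only [angularSpeed, ← hxdef, ← hxdef']; ring
    have h3 : |cos s ^ 2 * (h x - h x')| ≤ L * d := by
      rw [abs_mul, abs_of_nonneg (sq_nonneg _)]
      nlinarith [cos_sq_le_one s, abs_nonneg (h x - h x'), sq_nonneg (cos s)]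
    rw [e, abs_neg, abs_mul, abs_of_pos hω]
    nlinarith
  have hW := H.angularSpeed_pos l s
  have hW' := H.angularSpeed_pos l' s
  have e : polarField ω B h l s - polarField ω B h l' s =
      (-(radialSpeed ω B h l s - radialSpeed ω B h l' s) +
        polarField ω B h l' s * (angularSpeed ω h l' s - angularSpeed ω h l s)) /
        angularSpeed ω h l s := by
    unfold polarField
    field_simp
    ring
  have hnum : |-(radialSpeed ω B h l s - radialSpeed ω B h l' s) +
        polarField ω B h l' s * (angularSpeed ω h l' s - angularSpeed ω h l s)| ≤
        (3 * ω + 1) * L * d := by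
    refine (abs_add_le _ _).trans ?_
    rw [abs_neg, abs_mul]
    have := mul_le_mul (H.abs_polarField_le l' s) hΩ (abs_nonneg _) (by norm_num)
    nlinarith
  rw [e, abs_div, abs_of_pos hW, div_le_iff₀ hW]
  have hW2 := H.le_angularSpeed l s
  have : 0 ≤ 2 * (3 * ω + 1) * L / ω * d := by positivity
  calc _ ≤ (3 * ω + 1) * L * d := hnum
    _ = 2 * (3 * ω + 1) * L / ω * d * (ω / 2) := by field_simp
    _ ≤ _ := by gcongr

theorem polar_le_of_le (H : PlanarBounds ω L B h) {J : Set ℝ} (hJ : J.OrdConnected) {l l' : ℝ → ℝ}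
    (hl : ∀ s ∈ J, HasDerivAt l (polarField ω B h (l s) s) s)
    (hl' : ∀ s ∈ J, HasDerivAt l' (polarField ω B h (l' s) s) s)
    (h0 : ∀ s ∈ J, l s ≤ 0) (h0' : ∀ s ∈ J, l' s ≤ 0)
    {s t : ℝ} (hs : s ∈ J) (ht : t ∈ J) (hle : l s ≤ l' s) : l t ≤ l' t := by
  have := nonneg_of_abs_deriv_le hJ (D := fun s => l' s - l s) (K := 2 * (3 * ω + 1) * L / ω)
    (fun s hs => (hl' s hs).sub (hl s hs))
    (fun s hs => H.abs_polarField_sub_le (h0' s hs) (h0 s hs) s) hs ht (sub_nonneg.2 hle)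
  exact sub_nonneg.1 this

end PlanarBounds

namespace IsPlanarSolutionOn

variable {ω L : ℝ} {B h : ℝ → ℝ} {S : Set ℝ} {x y : ℝ → ℝ}

theorem normSq_pos (H : PlanarBounds ω L B h) (hS : S.OrdConnected)
    (hz : IsPlanarSolutionOn ω B h S x y) {s t : ℝ} (hs : s ∈ S) (ht : t ∈ S)
    (h0 : 0 < x s ^ 2 + y s ^ 2) : 0 < x t ^ 2 + y t ^ 2 := by
  refine lt_of_le_of_ne (by positivity) fun heq => h0.ne' ?_
  refine eq_zero_of_abs_deriv_le (E := fun t => x t ^ 2 + y t ^ 2)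
    (E' := fun t => 2 * x t * (ω * y t - x t * B (x t)) +
      2 * y t * (-(ω * x t * h (x t)) - y t * B (x t))) (k := 2 * ω) hS
    (fun t ht => by
      simpa using ((hz.deriv_x t ht).fun_pow 2).fun_add ((hz.deriv_y t ht).fun_pow 2))
    (fun t _ => by positivity) (fun t _ => ?_) ht hs heq.symm
  have e : 2 * x t * (ω * y t - x t * B (x t)) + 2 * y t * (-(ω * x t * h (x t)) - y t * B (x t))
      = -(2 * ω * (x t * y t) * (h (x t) - 1)) - 2 * (x t ^ 2 + y t ^ 2) * B (x t) := by ring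
  have hω := H.ω_pos
  have hxy : |x t * y t| ≤ (x t ^ 2 + y t ^ 2) / 2 := by
    rw [abs_le]; constructor <;> nlinarith [sq_nonneg (x t - y t), sq_nonneg (x t + y t)]
  have h1 : |x t * y t * (h (x t) - 1)| ≤ (x t ^ 2 + y t ^ 2) / 2 * (1 / 2) := by
    rw [abs_mul]; exact mul_le_mul hxy (H.bddh _) (abs_nonneg _) (by positivity)
  have h2 : |(x t ^ 2 + y t ^ 2) * B (x t)| ≤ (x t ^ 2 + y t ^ 2) * (ω / 2) := by
    rw [abs_mul, abs_of_nonneg (by positivity)]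
    exact mul_le_mul_of_nonneg_left (H.bddB _) (by positivity)
  have hr : 0 ≤ x t ^ 2 + y t ^ 2 := by positivity
  rw [e]
  refine (abs_sub _ _).trans ?_
  rw [abs_neg, mul_assoc (2 * ω), mul_assoc 2 (x t ^ 2 + y t ^ 2), abs_mul (2 * ω),
    abs_mul 2 (_ * _), abs_two, abs_of_pos (by positivity : 0 < 2 * ω)]
  nlinarith [mul_le_mul_of_nonneg_left h1 hω.le, mul_nonneg hω.le hr]

theorem exists_polarRep (H : PlanarBounds ω L B h) (hS : S.OrdConnected)
    (hz : IsPlanarSolutionOn ω B h S x y) {κ : ℝ → ℝ} (hκc : Continuous κ) (hκS : ∀ t, κ t ∈ S)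
    (hκ : ∀ t ∈ S, κ t = t) (h0 : (0 : ℝ) ∈ S) {r φ : ℝ} (hr : 0 < r)
    (hx0 : x 0 = r * cos φ) (hy0 : y 0 = r * sin φ) :
    ∃ l τ : ℝ → ℝ, IsPolarRep ω B h S x y l τ ∧ l φ = log r ∧ τ φ = 0 := by
  have hω := H.ω_pos
  have hpos : ∀ t, 0 < x (κ t) ^ 2 + y (κ t) ^ 2 := fun t =>
    hz.normSq_pos H hS h0 (hκS t) (by
      rw [hx0, hy0]; nlinarith [sin_sq_add_cos_sq φ, sq_pos_of_pos hr])
  have hBc : Continuous B := (LipschitzWith.of_dist_le_mul (K := ⟨L, H.L_nonneg⟩)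
    (fun a b => H.lipB a b)).continuous
  have hhc : Continuous h := (LipschitzWith.of_dist_le_mul (K := ⟨L, H.L_nonneg⟩)
    (fun a b => H.liph a b)).continuous
  have hxc : Continuous fun t => x (κ t) := hz.cont_x.comp hκc
  have hyc : Continuous fun t => y (κ t) := hz.cont_y.comp hκc
  set a : ℝ → ℝ := fun t => ω * (x (κ t) * y (κ t)) * (1 - h (x (κ t))) /
    (x (κ t) ^ 2 + y (κ t) ^ 2) - B (x (κ t)) with ha
  set w : ℝ → ℝ := fun t => ω * (y (κ t) ^ 2 + x (κ t) ^ 2 * h (x (κ t))) /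
    (x (κ t) ^ 2 + y (κ t) ^ 2) with hw
  have hac : Continuous a := by
    refine Continuous.sub (Continuous.div ?_ ?_ fun t => (hpos t).ne') (hBc.comp hxc)
    · exact (continuous_const.mul (hxc.mul hyc)).mul (continuous_const.sub (hhc.comp hxc))
    · exact (hxc.pow 2).add (hyc.pow 2)
  have hwc : Continuous w := by
    refine Continuous.div ?_ ?_ fun t => (hpos t).ne'
    · exact continuous_const.mul ((hyc.pow 2).add ((hxc.pow 2).mul (hhc.comp hxc)))
    · exact (hxc.pow 2).add (hyc.pow 2)
  have hwlow : ∀ t, ω / 2 ≤ w t := by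
    intro t
    rw [hw, le_div_iff₀ (hpos t)]
    have := (H.h_mem (x (κ t))).1
    have h1 : (x (κ t) ^ 2 + y (κ t) ^ 2) / 2 ≤ y (κ t) ^ 2 + x (κ t) ^ 2 * h (x (κ t)) := by
      nlinarith [sq_nonneg (x (κ t)), sq_nonneg (y (κ t)),
        mul_le_mul_of_nonneg_left this (sq_nonneg (x (κ t)))]
    nlinarith
  have ha_le : ∀ t, |a t| ≤ ω := by
    intro t
    have hxy : |x (κ t) * y (κ t)| ≤ (x (κ t) ^ 2 + y (κ t) ^ 2) / 2 := by
      rw [abs_le]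
      constructor <;> nlinarith [sq_nonneg (x (κ t) - y (κ t)), sq_nonneg (x (κ t) + y (κ t))]
    have h1 : |ω * (x (κ t) * y (κ t)) * (1 - h (x (κ t))) / (x (κ t) ^ 2 + y (κ t) ^ 2)|
        ≤ ω / 2 := by
      rw [abs_div, abs_of_pos (hpos t), div_le_iff₀ (hpos t), mul_assoc, abs_mul, abs_of_pos hω,
        abs_mul, abs_sub_comm]
      have := mul_le_mul hxy (H.bddh (x (κ t))) (abs_nonneg _) (by linarith [hpos t])
      nlinarith [mul_le_mul_of_nonneg_left this hω.le, mul_pos hω (hpos t)]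
    calc |a t| ≤ _ := abs_sub _ _
      _ ≤ ω / 2 + ω / 2 := add_le_add h1 (H.bddB _)
      _ = ω := by ring
  have hsys : ∀ t ∈ S, a t * x t + w t * y t = ω * y t - x t * B (x t) ∧
      a t * y t - w t * x t = -(ω * x t * h (x t)) - y t * B (x t) := by
    intro t ht
    have hp := hpos t
    simp only [ha, hw, hκ t ht] at hp ⊢
    constructor <;> field_simp <;> ring
  have hwpos : ∀ t, 0 < w t := fun t => (half_pos hω).trans_le (hwlow t)
  set ℓ : ℝ → ℝ := fun t => log r + ∫ s in (0 : ℝ)..t, a s with hℓ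
  set θ : ℝ → ℝ := fun t => φ - ∫ s in (0 : ℝ)..t, w s with hθ
  have hℓd : ∀ t, HasDerivAt ℓ (a t) t := fun t =>
    (hac.integral_hasStrictDerivAt 0 t).hasDerivAt.const_add _
  have hθd : ∀ t, HasDerivAt θ (-w t) t := fun t =>
    (hwc.integral_hasStrictDerivAt 0 t).hasDerivAt.const_sub _
  have hℓ0 : ℓ 0 = log r := by simp [hℓ]
  have hθ0 : θ 0 = φ := by simp [hθ]
  have hθanti : StrictAnti θ := strictAnti_of_deriv_neg fun t => by
    rw [(hθd t).deriv]; linarith [hwpos t]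
  have hψ : Antitone fun t => θ t + ω / 2 * t := by
    have hd : ∀ t, HasDerivAt (fun t => θ t + ω / 2 * t) (-w t + ω / 2 * 1) t := fun t =>
      (hθd t).add ((hasDerivAt_id t).const_mul _)
    refine antitone_of_deriv_nonpos (fun t => (hd t).differentiableAt) fun t => ?_
    rw [(hd t).deriv]; linarith [hwlow t]
  have hθc : Continuous θ := continuous_iff_continuousAt.2 fun t => (hθd t).continuousAt
  have hθsurj : Function.Surjective θ := by
    refine hθc.surjective' ?_ ?_
    · refine Filter.tendsto_atTop.2 fun b => ?_
      filter_upwards [Filter.eventually_le_atBot 0,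
        Filter.eventually_le_atBot ((φ - b) / (ω / 2))] with t ht ht2
      have := hψ ht
      have h3 := (le_div_iff₀ (half_pos hω)).1 ht2
      simp only [hθ0, mul_zero, add_zero] at this
      linarith
    · refine Filter.tendsto_atBot.2 fun b => ?_
      filter_upwards [Filter.eventually_ge_atTop 0,
        Filter.eventually_ge_atTop ((φ - b) / (ω / 2))] with t ht ht2
      have := hψ ht
      have h3 := (div_le_iff₀ (half_pos hω)).1 ht2
      simp only [hθ0, mul_zero, add_zero] at this
      linarith
  set τ := Function.surjInv hθsurj with hτ
  have hθτ : ∀ s, θ (τ s) = s := Function.surjInv_eq hθsurj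
  have hτθ : ∀ t, τ (θ t) = t := fun t => hθanti.injective (hθτ _)
  have hτanti : StrictAnti τ := fun s s' hss => by
    rw [← hθanti.lt_iff_gt, hθτ, hθτ]; exact hss
  have hτsurj : Function.Surjective τ := fun t => ⟨θ t, hτθ t⟩
  have hτc : Continuous τ := by
    have : Continuous fun s => -τ s := Monotone.continuous_of_surjective
      (fun s s' hss => neg_le_neg (hτanti.antitone hss))
      (fun t => ⟨θ (-t), by simp [hτθ]⟩)
    exact (continuous_neg.comp this).congr fun s => neg_neg _
  have hτd : ∀ s, HasDerivAt τ (-w (τ s))⁻¹ s := fun s =>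
    HasDerivAt.of_local_left_inverse hτc.continuousAt (hθd _) (by linarith [hwpos (τ s)])
      (Filter.Eventually.of_forall hθτ)
  have hld : ∀ s, HasDerivAt (fun s => ℓ (τ s)) (a (τ s) * (-w (τ s))⁻¹) s := fun s =>
    (hℓd (τ s)).comp s (hτd s)
  have hcart : ∀ t ∈ S, x t = exp (ℓ t) * cos (θ t) ∧ y t = exp (ℓ t) * sin (θ t) := by
    intro t ht
    have hxd : ∀ t ∈ S, HasDerivAt (fun t => x t - exp (ℓ t) * cos (θ t))
        (a t * (x t - exp (ℓ t) * cos (θ t)) + w t * (y t - exp (ℓ t) * sin (θ t))) t := by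
      intro t ht
      refine ((hz.deriv_x t ht).fun_sub ((hℓd t).exp.fun_mul (hθd t).cos)).congr_deriv ?_
      linear_combination -(hsys t ht).1
    have hyd : ∀ t ∈ S, HasDerivAt (fun t => y t - exp (ℓ t) * sin (θ t))
        (a t * (y t - exp (ℓ t) * sin (θ t)) - w t * (x t - exp (ℓ t) * cos (θ t))) t := by
      intro t ht
      refine ((hz.deriv_y t ht).fun_sub ((hℓd t).exp.fun_mul (hθd t).sin)).congr_deriv ?_
      linear_combination -(hsys t ht).2
    have h2 := eq_zero_of_abs_deriv_le (S := S) (k := 2 * ω)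
      (E := fun t => (x t - exp (ℓ t) * cos (θ t)) ^ 2 + (y t - exp (ℓ t) * sin (θ t)) ^ 2)
      (E' := fun t => 2 * a t *
        ((x t - exp (ℓ t) * cos (θ t)) ^ 2 + (y t - exp (ℓ t) * sin (θ t)) ^ 2)) hS
      (fun t ht => by
        refine (((hxd t ht).fun_pow 2).fun_add ((hyd t ht).fun_pow 2)).congr_deriv ?_
        push_cast
        ring)
      (fun t _ => by positivity)
      (fun t _ => by
        rw [abs_mul, abs_mul, abs_two, abs_of_nonneg (by positivity :
          0 ≤ (x t - exp (ℓ t) * cos (θ t)) ^ 2 + (y t - exp (ℓ t) * sin (θ t)) ^ 2)]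
        have := ha_le t
        gcongr)
      h0 ht (by simp [hℓ0, hθ0, exp_log hr, hx0, hy0])
    constructor <;> nlinarith [sq_nonneg (x t - exp (ℓ t) * cos (θ t)),
      sq_nonneg (y t - exp (ℓ t) * sin (θ t))]
  have hwS : ∀ s, τ s ∈ S → w (τ s) = angularSpeed ω h (ℓ (τ s)) s := by
    intro s hs
    obtain ⟨h1, h2⟩ := hcart _ hs
    rw [hθτ] at h1 h2
    simp only [hw, hκ _ hs, angularSpeed, ← h1]
    have he := exp_pos (ℓ (τ s))
    have hr2 : x (τ s) ^ 2 + y (τ s) ^ 2 = exp (ℓ (τ s)) ^ 2 := by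
      rw [h1, h2]; linear_combination exp (ℓ (τ s)) ^ 2 * sin_sq_add_cos_sq s
    rw [hr2, div_eq_iff (by positivity), h2]
    generalize h (x (τ s)) = H'
    rw [h1]
    ring
  have haS : ∀ s, τ s ∈ S → a (τ s) = radialSpeed ω B h (ℓ (τ s)) s := by
    intro s hs
    obtain ⟨h1, h2⟩ := hcart _ hs
    rw [hθτ] at h1 h2
    simp only [ha, hκ _ hs, radialSpeed, ← h1]
    have he := exp_pos (ℓ (τ s))
    have hr2 : x (τ s) ^ 2 + y (τ s) ^ 2 = exp (ℓ (τ s)) ^ 2 := by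
      rw [h1, h2]; linear_combination exp (ℓ (τ s)) ^ 2 * sin_sq_add_cos_sq s
    rw [hr2, sub_left_inj, div_eq_iff (by positivity), h2]
    generalize h (x (τ s)) = H'
    rw [h1]
    ring
  have hτφ : τ φ = 0 := by rw [← hθ0, hτθ]
  refine ⟨fun s => ℓ (τ s), τ, ⟨hτanti, hτsurj, ?_, ?_, ?_, ?_, ?_⟩, by simp [hτφ, hℓ0], hτφ⟩
  · intro s s'
    have := Convex.norm_image_sub_le_of_norm_hasDerivWithin_le (C := 2)
      (fun s _ => (hld s).hasDerivWithinAt) (fun s _ => ?_) convex_univ (mem_univ s') (mem_univ s)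
    · simpa using this
    · rw [norm_mul, norm_inv, norm_neg, Real.norm_eq_abs, Real.norm_eq_abs,
        abs_of_pos (hwpos _), ← div_eq_mul_inv, div_le_iff₀ (hwpos _)]
      linarith [ha_le (τ s), hwlow (τ s)]
  · intro s hs; have := (hcart _ hs).1; rwa [hθτ] at this
  · intro s hs; have := (hcart _ hs).2; rwa [hθτ] at this
  · intro s hs
    have := hld s
    rwa [haS s hs, hwS s hs, inv_neg, mul_neg, ← div_eq_mul_inv] at this
  · intro s hs
    have := hτd s
    rwa [hwS s hs, inv_neg] at this

end IsPlanarSolutionOn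

theorem exists_first_hitting_time {N : ℝ → ℝ} (hN : Continuous N) {c : ℝ} (h0 : N 0 < c)
    (h : ∃ t, 0 ≤ t ∧ c ≤ N t) :
    ∃ t₁, 0 < t₁ ∧ N t₁ = c ∧ ∀ t ∈ Icc 0 t₁, N t ≤ c := by
  set A : Set ℝ := {t | 0 ≤ t ∧ c ≤ N t} with hA
  have hcl : IsClosed A := isClosed_Ici.inter (isClosed_Ici.preimage hN)
  have hbdd : BddBelow A := ⟨0, fun t ht => ht.1⟩
  have hmem : sInf A ∈ A := hcl.csInf_mem h hbdd
  obtain ⟨t, ht, htc⟩ := intermediate_value_Icc hmem.1 hN.continuousOn ⟨h0.le, hmem.2⟩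
  have hle : sInf A ≤ t := csInf_le hbdd ⟨ht.1, htc.ge⟩
  have heq : t = sInf A := le_antisymm ht.2 hle
  have hval : N (sInf A) = c := heq ▸ htc
  refine ⟨sInf A, lt_of_le_of_ne hmem.1 fun h0' => ?_, hval, fun s hs => ?_⟩
  · rw [← h0'] at hval; exact h0.ne hval
  · by_contra! hlt
    have : sInf A ≤ s := csInf_le hbdd ⟨hs.1, hlt.le⟩
    rw [le_antisymm this hs.2, hs.2.antisymm this] at hval
    exact hlt.ne' (by rw [hs.2.antisymm this]; exact hval)

theorem polarField_sub_two_pi (ω : ℝ) (B h : ℝ → ℝ) (l s : ℝ) :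
    polarField ω B h l (s - 2 * π) = polarField ω B h l s := by
  simp [polarField, radialSpeed, angularSpeed]

theorem angularSpeed_sub_two_pi (ω : ℝ) (h : ℝ → ℝ) (l s : ℝ) :
    angularSpeed ω h l (s - 2 * π) = angularSpeed ω h l s := by
  simp [angularSpeed]

/-- A periodic orbit starting close enough to the origin never leaves a given disc. -/
theorem PlanarBounds.normSq_lt {ω L : ℝ} {B h : ℝ → ℝ} (H : PlanarBounds ω L B h)
    {x y : ℝ → ℝ} (hxc : Continuous x) (hyc : Continuous y) {p : ℝ} (hp : 0 < p)
    (hxp : ∀ t, x (t + p) = x t) (hyp : ∀ t, y (t + p) = y t) {η : ℝ} (hη : 0 < η) (hη1 : η ≤ 1)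
    (hdx : ∀ t, x t ^ 2 + y t ^ 2 ≤ η ^ 2 → HasDerivAt x (ω * y t - x t * B (x t)) t)
    (hdy : ∀ t, x t ^ 2 + y t ^ 2 ≤ η ^ 2 →
      HasDerivAt y (-(ω * x t * h (x t)) - y t * B (x t)) t)
    {r φ : ℝ} (hr : 0 < r) (hx0 : x 0 = r * cos φ) (hy0 : y 0 = r * sin φ)
    (hrη : log r < log η - 8 * π) (t : ℝ) : x t ^ 2 + y t ^ 2 < η ^ 2 := by
  by_contra! hbig
  have hπ := pi_pos
  set N : ℝ → ℝ := fun t => x t ^ 2 + y t ^ 2 with hN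
  have hNc : Continuous N := (hxc.pow 2).add (hyc.pow 2)
  have hNp : Function.Periodic N p := fun t => by simp [hN, hxp, hyp]
  have hN0 : N 0 < η ^ 2 := by
    have h1 : N 0 = r ^ 2 := by
      simp only [hN, hx0, hy0]; linear_combination r ^ 2 * sin_sq_add_cos_sq φ
    have h2 : r < η := (log_lt_log_iff hr hη).1 (by linarith)
    rw [h1]; gcongr
  obtain ⟨n, hn⟩ := exists_nat_ge (|t| / p)
  have hn' : |t| ≤ n * p := (div_le_iff₀ hp).1 hn
  have ht := abs_le.1 hn'
  obtain ⟨t₁, ht₁, hNt₁, hle₁⟩ := exists_first_hitting_time hNc hN0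
    ⟨t + n * p, by linarith, by rw [(hNp.nat_mul n) t]; exact hbig⟩
  obtain ⟨t₂, ht₂, hNt₂, hle₂⟩ := exists_first_hitting_time (N := fun t => N (-t))
    (hNc.comp continuous_neg) (by simpa using hN0)
    ⟨-(t - n * p), by linarith, by simp only [neg_neg]; rw [hNp.sub_nat_mul_eq n]; exact hbig⟩
  have hle : ∀ t ∈ Icc (-t₂) t₁, N t ≤ η ^ 2 := by
    intro t ht
    rcases le_total 0 t with h0 | h0
    · exact hle₁ t ⟨h0, ht.2⟩
    · simpa using hle₂ (-t) ⟨by linarith, by linarith [ht.1]⟩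
  have h12 : -t₂ ≤ t₁ := by linarith
  have hz : IsPlanarSolutionOn ω B h (Icc (-t₂) t₁) x y :=
    ⟨hxc, hyc, fun t ht => hdx t (hle t ht), fun t ht => hdy t (hle t ht)⟩
  obtain ⟨l, τ, hrep, hlφ, hτφ⟩ := hz.exists_polarRep H ordConnected_Icc
    (κ := fun t => projIcc (-t₂) t₁ h12 t) (continuous_subtype_val.comp continuous_projIcc)
    (fun t => (projIcc (-t₂) t₁ h12 t).2) (fun t ht => by rw [projIcc_of_mem h12 ht])
    ⟨by linarith, ht₁.le⟩ hr hx0 hy0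
  obtain ⟨s₁, hs₁⟩ := hrep.surj t₁
  obtain ⟨s₂, hs₂⟩ := hrep.surj (-t₂)
  have hmem : ∀ s ∈ Icc s₁ s₂, τ s ∈ Icc (-t₂) t₁ := fun s hs =>
    ⟨hs₂ ▸ hrep.anti.antitone hs.2, hs₁ ▸ hrep.anti.antitone hs.1⟩
  have hs₁φ : s₁ < φ := hrep.anti.lt_iff_gt.1 (by rw [hτφ, hs₁]; exact ht₁)
  have hφs₂ : φ < s₂ := hrep.anti.lt_iff_gt.1 (by rw [hτφ, hs₂]; linarith)
  have hNl : ∀ s ∈ Icc s₁ s₂, N (τ s) = exp (l s) ^ 2 := by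
    intro s hs
    simp only [hN, hrep.x_eq s (hmem s hs), hrep.y_eq s (hmem s hs)]
    linear_combination exp (l s) ^ 2 * sin_sq_add_cos_sq s
  have hl_le : ∀ s ∈ Icc s₁ s₂, l s ≤ log η := by
    intro s hs
    have h1 := hle _ (hmem s hs)
    rw [hNl s hs] at h1
    rw [le_log_iff_exp_le hη]
    exact le_of_sq_le_sq h1 hη.le
  have hl_nonpos : ∀ s ∈ Icc s₁ s₂, l s ≤ 0 := fun s hs =>
    (hl_le s hs).trans (log_nonpos hη.le hη1)
  have hl_eq : ∀ s ∈ Icc s₁ s₂, N (τ s) = η ^ 2 → l s = log η := by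
    intro s hs h1
    rw [hNl s hs] at h1
    rw [← (pow_left_inj₀ (exp_pos _).le hη.le two_ne_zero).1 h1, log_exp]
  have hls₁ : l s₁ = log η := hl_eq s₁ ⟨le_rfl, by linarith⟩ (by rw [hs₁, hNt₁])
  have hls₂ : l s₂ = log η := hl_eq s₂ ⟨by linarith, le_rfl⟩ (by rw [hs₂]; exact hNt₂)
  have hnear : ∀ s, |s - φ| ≤ 4 * π → l s < log η := by
    intro s hs
    have := (abs_le.1 (hrep.lip s φ)).2
    linarith
  have hs₁far : s₁ + 4 * π < φ := by
    by_contra! hcon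
    exact (hnear s₁ (abs_le.2 ⟨by linarith, by linarith⟩)).ne hls₁
  have hs₂far : φ + 4 * π < s₂ := by
    by_contra! hcon
    exact (hnear s₂ (abs_le.2 ⟨by linarith, by linarith⟩)).ne hls₂
  have hd : ∀ s ∈ Icc (s₁ + 2 * π) s₂, HasDerivAt l (polarField ω B h (l s) s) s := fun s hs =>
    hrep.deriv_l s (hmem s ⟨by linarith [hs.1], hs.2⟩)
  have hd' : ∀ s ∈ Icc (s₁ + 2 * π) s₂, HasDerivAt (fun s => l (s - 2 * π))
      (polarField ω B h (l (s - 2 * π)) s) s := fun s hs => by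
    have := hrep.deriv_l (s - 2 * π) (hmem _ ⟨by linarith [hs.1], by linarith [hs.2]⟩)
    rw [polarField_sub_two_pi] at this
    exact this.comp_sub_const s (2 * π)
  have hneg : ∀ s ∈ Icc (s₁ + 2 * π) s₂, l s ≤ 0 := fun s hs =>
    hl_nonpos s ⟨by linarith [hs.1], hs.2⟩
  have hneg' : ∀ s ∈ Icc (s₁ + 2 * π) s₂, l (s - 2 * π) ≤ 0 := fun s hs =>
    hl_nonpos _ ⟨by linarith [hs.1], by linarith [hs.2]⟩
  have hφmem : φ ∈ Icc (s₁ + 2 * π) s₂ := ⟨by linarith, by linarith⟩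
  rcases le_total (l (φ - 2 * π)) (l φ) with hc | hc
  · have hstep : ∀ s ∈ Icc (s₁ + 2 * π) s₂, l (s - 2 * π) ≤ l s := fun s hs =>
      H.polar_le_of_le ordConnected_Icc hd' hd hneg' hneg hφmem hs hc
    have hind : ∀ n : ℕ, s₁ + 2 * π * n ≤ s₂ → l s₁ ≤ l (s₁ + 2 * π * n) := by
      intro n
      induction n with
      | zero => simp
      | succ n ih =>
        intro hn
        push_cast at hn ⊢
        have h0 : 0 ≤ 2 * π * n := by positivity
        refine (ih (by linarith)).trans ?_
        have := hstep (s₁ + 2 * π * (n + 1)) ⟨by linarith, hn⟩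
        rwa [show s₁ + 2 * π * (n + 1) - 2 * π = s₁ + 2 * π * n by ring] at this
    set n := ⌊(φ - s₁) / (2 * π)⌋₊
    have h1 : n * (2 * π) ≤ φ - s₁ :=
      (le_div_iff₀ (by positivity)).1 (Nat.floor_le (div_nonneg (by linarith) (by positivity)))
    have h2 : φ - s₁ < (n + 1) * (2 * π) :=
      (div_lt_iff₀ (by positivity)).1 (Nat.lt_floor_add_one _)
    have h3 := hind n (by linarith)
    have h4 := hnear (s₁ + 2 * π * n) (abs_le.2 ⟨by linarith, by linarith⟩)
    linarith
  · have hstep : ∀ s ∈ Icc (s₁ + 2 * π) s₂, l s ≤ l (s - 2 * π) := fun s hs =>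
      H.polar_le_of_le ordConnected_Icc hd hd' hneg hneg' hφmem hs hc
    have hind : ∀ n : ℕ, s₁ ≤ s₂ - 2 * π * n → l s₂ ≤ l (s₂ - 2 * π * n) := by
      intro n
      induction n with
      | zero => simp
      | succ n ih =>
        intro hn
        push_cast at hn ⊢
        have h0 : 0 ≤ 2 * π * n := by positivity
        refine (ih (by linarith)).trans ?_
        have := hstep (s₂ - 2 * π * n) ⟨by linarith, by linarith⟩
        rwa [show s₂ - 2 * π * n - 2 * π = s₂ - 2 * π * (n + 1) by ring] at this
    set n := ⌊(s₂ - φ) / (2 * π)⌋₊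
    have h1 : n * (2 * π) ≤ s₂ - φ :=
      (le_div_iff₀ (by positivity)).1 (Nat.floor_le (div_nonneg (by linarith) (by positivity)))
    have h2 : s₂ - φ < (n + 1) * (2 * π) :=
      (div_lt_iff₀ (by positivity)).1 (Nat.lt_floor_add_one _)
    have h3 := hind n (by linarith)
    have h4 := hnear (s₂ - 2 * π * n) (abs_le.2 ⟨by linarith, by linarith⟩)
    linarith

namespace IsPolarRep

variable {ω L : ℝ} {B h : ℝ → ℝ}

/-- On a closed orbit the log-radius is `2π`-periodic in the angle and one turn takes exactly one
minimal period. -/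
theorem sub_two_pi (H : PlanarBounds ω L B h) {x y l τ : ℝ → ℝ}
    (hrep : IsPolarRep ω B h univ x y l τ) (hl : ∀ s, l s ≤ 0) {T : ℝ} (hT : 0 < T)
    (hxT : ∀ t, x (t + T) = x t) (hyT : ∀ t, y (t + T) = y t)
    (hmin : ∀ p > 0, (∀ t, x (t + p) = x t) → T ≤ p) (s : ℝ) :
    τ (s - 2 * π) = τ s + T := by
  have hπ := pi_pos
  obtain ⟨s₁, hs₁⟩ := hrep.surj (τ 0 + T)
  have hs₁0 : s₁ < 0 := hrep.anti.lt_iff_gt.1 (by linarith)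
  have hx := hrep.x_eq s₁ (mem_univ _)
  have hy := hrep.y_eq s₁ (mem_univ _)
  rw [hs₁, hxT, hrep.x_eq 0 (mem_univ _)] at hx
  rw [hs₁, hyT, hrep.y_eq 0 (mem_univ _)] at hy
  have hexp : exp (l 0) = exp (l s₁) := by
    refine (pow_left_inj₀ (exp_pos _).le (exp_pos _).le two_ne_zero).1 ?_
    have h1 := sin_sq_add_cos_sq s₁
    have h0 := sin_sq_add_cos_sq 0
    calc exp (l 0) ^ 2 = (exp (l 0) * cos 0) ^ 2 + (exp (l 0) * sin 0) ^ 2 := by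
          linear_combination -exp (l 0) ^ 2 * h0
      _ = exp (l s₁) ^ 2 := by rw [hx, hy]; linear_combination exp (l s₁) ^ 2 * h1
  rw [hexp] at hx hy
  have hcos := mul_left_cancel₀ (exp_pos _).ne' hx
  have hsin := mul_left_cancel₀ (exp_pos _).ne' hy
  obtain ⟨k, hk⟩ := Real.Angle.angle_eq_iff_two_pi_dvd_sub.1 (Real.Angle.cos_sin_inj hcos hsin)
  have hkpos : 0 < k := by
    have : (0 : ℝ) < k := by
      by_contra! hk0
      nlinarith
    exact_mod_cast this
  obtain ⟨n, rfl⟩ : ∃ n : ℕ, k = n + 1 := ⟨(k - 1).toNat, by omega⟩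
  have hs₁n : s₁ = 0 - 2 * π * (n + 1) := by push_cast at hk; linarith
  have hd : ∀ s ∈ univ, HasDerivAt l (polarField ω B h (l s) s) s := fun s hs =>
    hrep.deriv_l s (mem_univ _)
  have hd' : ∀ s ∈ univ, HasDerivAt (fun s => l (s - 2 * π))
      (polarField ω B h (l (s - 2 * π)) s) s := fun s hs => by
    have := hrep.deriv_l (s - 2 * π) (mem_univ _)
    rw [polarField_sub_two_pi] at this
    exact this.comp_sub_const s (2 * π)
  have hle : l (0 - 2 * π) ≤ l 0 → ∀ s, l (s - 2 * π) ≤ l s := fun h s =>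
    H.polar_le_of_le ordConnected_univ hd' hd (fun s _ => hl _) (fun s _ => hl _) (mem_univ _)
      (mem_univ s) h
  have hge : l 0 ≤ l (0 - 2 * π) → ∀ s, l s ≤ l (s - 2 * π) := fun h s =>
    H.polar_le_of_le ordConnected_univ hd hd' (fun s _ => hl _) (fun s _ => hl _) (mem_univ _)
      (mem_univ s) h
  have hl₁ : l (0 - 2 * π * (n + 1)) = l 0 := by
    rw [← hs₁n]; exact (exp_injective hexp).symm
  have hstep : ∀ m : ℕ, (0 - 2 * π * (m + 1) : ℝ) - 2 * π = 0 - 2 * π * ((m + 1 : ℕ) + 1) := by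
    intro m; push_cast; ring
  have hper0 : l (0 - 2 * π) = l 0 := by
    rcases le_total (l (0 - 2 * π)) (l 0) with hc | hc
    · refine le_antisymm hc (hl₁ ▸ ?_)
      clear hl₁ hs₁n hk hkpos
      induction n with
      | zero => simp
      | succ n ih => exact (hstep n ▸ hle hc _).trans ih
    · refine le_antisymm (hl₁ ▸ ?_) hc
      clear hl₁ hs₁n hk hkpos
      induction n with
      | zero => simp
      | succ n ih => exact ih.trans (hstep n ▸ hge hc _)
  have hper : ∀ s, l (s - 2 * π) = l s := fun s =>
    le_antisymm (hle hper0.le s) (hge hper0.ge s)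
  have hconst : ∀ s, τ (s - 2 * π) - τ s = τ (0 - 2 * π) - τ 0 := by
    intro s
    have hdτ : ∀ s, HasDerivAt (fun s => τ (s - 2 * π) - τ s) 0 s := by
      intro s
      have h1 := (hrep.deriv_τ (s - 2 * π) (mem_univ _)).comp_sub_const s (2 * π)
      rw [hper, angularSpeed_sub_two_pi] at h1
      simpa using h1.fun_sub (hrep.deriv_τ s (mem_univ _))
    exact is_const_of_deriv_eq_zero (fun s => (hdτ s).differentiableAt)
      (fun s => (hdτ s).deriv) s 0
  have hTle : T ≤ τ (0 - 2 * π) - τ 0 := by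
    refine hmin _ (sub_pos.2 (hrep.anti (by linarith))) fun t => ?_
    obtain ⟨s, rfl⟩ := hrep.surj t
    rw [← hconst s, add_sub_cancel, hrep.x_eq _ (mem_univ _), hrep.x_eq _ (mem_univ _), hper,
      cos_sub_two_pi]
  have hleT : τ (0 - 2 * π) ≤ τ 0 + T := by
    rw [← hs₁]
    refine hrep.anti.antitone ?_
    rw [hs₁n]
    have : (0 : ℝ) ≤ n := n.cast_nonneg
    nlinarith
  linarith [hconst s]

/-- Orbits are ordered as the abscissae of their points on the section `x' = 0`. -/
theorem le_of_lt (H : PlanarBounds ω L B h) {η : ℝ} (hη : 0 < η) (hη1 : η ≤ 1)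
    (hηL : 6 * (η * L) ≤ ω) {x₁ y₁ l₁ τ₁ x₂ y₂ l₂ τ₂ : ℝ → ℝ}
    (h₁ : IsPolarRep ω B h univ x₁ y₁ l₁ τ₁) (h₂ : IsPolarRep ω B h univ x₂ y₂ l₂ τ₂)
    (hl₁ : ∀ s, l₁ s ≤ log η) (hl₂ : ∀ s, l₂ s ≤ log η) {φ₁ φ₂ : ℝ} (hτ₁ : τ₁ φ₁ = 0)
    (hτ₂ : τ₂ φ₂ = 0) (hφ : |φ₂ - φ₁| ≤ L / ω * |x₂ 0 - x₁ 0|) (hcos : 0 < cos φ₂)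
    (hx : x₁ 0 < x₂ 0) (s : ℝ) : l₁ s ≤ l₂ s := by
  have hlog : log η ≤ 0 := log_nonpos hη.le hη1
  have key : ∀ {l l' : ℝ → ℝ}, (∀ s ∈ univ, HasDerivAt l (polarField ω B h (l s) s) s) →
      (∀ s ∈ univ, HasDerivAt l' (polarField ω B h (l' s) s) s) → (∀ s, l s ≤ log η) →
      (∀ s, l' s ≤ log η) → l 0 ≤ l' 0 → ∀ s, l s ≤ l' s := fun hd hd' hl hl' h0 s =>
    H.polar_le_of_le ordConnected_univ hd hd' (fun s _ => (hl s).trans hlog)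
      (fun s _ => (hl' s).trans hlog) (mem_univ _) (mem_univ s) h0
  have hd₁ : ∀ s ∈ univ, HasDerivAt l₁ (polarField ω B h (l₁ s) s) s := fun s _ =>
    h₁.deriv_l s (mem_univ _)
  have hd₂ : ∀ s ∈ univ, HasDerivAt l₂ (polarField ω B h (l₂ s) s) s := fun s _ =>
    h₂.deriv_l s (mem_univ _)
  rcases le_total (l₁ 0) (l₂ 0) with hc | hc
  · exact key hd₁ hd₂ hl₁ hl₂ hc s
  exfalso
  have hle := key hd₂ hd₁ hl₂ hl₁ hc
  have hX₁ := h₁.x_eq φ₁ (mem_univ _)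
  have hX₂ := h₂.x_eq φ₂ (mem_univ _)
  rw [hτ₁] at hX₁
  rw [hτ₂] at hX₂
  have hXd : ∀ s, HasDerivAt (fun s => exp (l₁ s) * cos s)
      (exp (l₁ s) * polarField ω B h (l₁ s) s * cos s + exp (l₁ s) * -sin s) s := fun s =>
    (hd₁ s (mem_univ _)).exp.mul (hasDerivAt_cos s)
  have hXlip := Convex.norm_image_sub_le_of_norm_hasDerivWithin_le (C := 3 * η)
    (fun s _ => (hXd s).hasDerivWithinAt) (fun s _ => by
      have he : exp (l₁ s) ≤ η := (le_log_iff_exp_le hη).1 (hl₁ s)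
      have h1 : |polarField ω B h (l₁ s) s * cos s| ≤ 2 * 1 := by
        rw [abs_mul]
        exact mul_le_mul (H.abs_polarField_le _ _) (abs_cos_le_one _) (abs_nonneg _) two_pos.le
      have h2 := abs_sin_le_one s
      have h3 : |polarField ω B h (l₁ s) s * cos s - sin s| ≤ 3 := by
        refine (abs_sub _ _).trans ?_
        linarith
      rw [show exp (l₁ s) * polarField ω B h (l₁ s) s * cos s + exp (l₁ s) * -sin s =
        exp (l₁ s) * (polarField ω B h (l₁ s) s * cos s - sin s) by ring, Real.norm_eq_abs,
        abs_mul, abs_of_pos (exp_pos _), mul_comm 3]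
      exact mul_le_mul he h3 (abs_nonneg _) hη.le) convex_univ (mem_univ φ₁) (mem_univ φ₂)
  simp only [Real.norm_eq_abs] at hXlip
  have h4 : exp (l₂ φ₂) * cos φ₂ ≤ exp (l₁ φ₂) * cos φ₂ := by
    have := hle φ₂
    gcongr
  have h5 := (abs_le.1 hXlip).2
  have h6 : 3 * η * |φ₂ - φ₁| ≤ 1 / 2 * |x₂ 0 - x₁ 0| := by
    calc 3 * η * |φ₂ - φ₁| ≤ 3 * η * (L / ω * |x₂ 0 - x₁ 0|) := by gcongr
      _ = 3 * (η * L) / ω * |x₂ 0 - x₁ 0| := by ring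
      _ ≤ _ := by
        refine mul_le_mul_of_nonneg_right ?_ (abs_nonneg _)
        rw [div_le_iff₀ H.ω_pos]; linarith
  rw [abs_of_pos (sub_pos.2 hx)] at h6
  linarith

theorem period_le {x₁ y₁ l₁ τ₁ x₂ y₂ l₂ τ₂ : ℝ → ℝ} (H : PlanarBounds ω L B h)
    (h₁ : IsPolarRep ω B h univ x₁ y₁ l₁ τ₁) (h₂ : IsPolarRep ω B h univ x₂ y₂ l₂ τ₂)
    {T₁ T₂ : ℝ} (hT₁ : ∀ s, τ₁ (s - 2 * π) = τ₁ s + T₁) (hT₂ : ∀ s, τ₂ (s - 2 * π) = τ₂ s + T₂)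
    (hΩ : ∀ s, angularSpeed ω h (l₁ s) s ≤ angularSpeed ω h (l₂ s) s) : T₂ ≤ T₁ := by
  have hd : ∀ s, HasDerivAt (fun s => τ₁ s - τ₂ s)
      (-(angularSpeed ω h (l₁ s) s)⁻¹ - -(angularSpeed ω h (l₂ s) s)⁻¹) s := fun s =>
    (h₁.deriv_τ s (mem_univ _)).sub (h₂.deriv_τ s (mem_univ _))
  have hanti : Antitone fun s => τ₁ s - τ₂ s := by
    refine antitone_of_deriv_nonpos (fun s => (hd s).differentiableAt) fun s => ?_
    rw [(hd s).deriv]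
    have := inv_anti₀ (H.angularSpeed_pos (l₁ s) s) (hΩ s)
    linarith
  have := hanti (show 0 - 2 * π ≤ 0 by linarith [pi_pos])
  simp only [hT₁, hT₂] at this
  linarith

end IsPolarRep

theorem PlanarBounds.angularSpeed_le {ω L : ℝ} {B h : ℝ → ℝ} (H : PlanarBounds ω L B h) {l l' s : ℝ}
    (hl : l ≤ l') (hmono : ∀ q ∈ Icc (0 : ℝ) 1, h (q * (exp l' * cos s)) ≤ h (exp l' * cos s)) :
    angularSpeed ω h l s ≤ angularSpeed ω h l' s := by
  have := hmono (exp (l - l')) ⟨(exp_pos _).le, exp_le_one_iff.2 (by linarith)⟩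
  rw [← mul_assoc, ← exp_add, sub_add_cancel] at this
  have hω := H.ω_pos
  unfold angularSpeed
  gcongr

theorem PlanarBounds.le_angularSpeed_of_le {ω L : ℝ} {B h : ℝ → ℝ} (H : PlanarBounds ω L B h)
    {l l' s : ℝ} (hl : l ≤ l')
    (hmono : ∀ q ∈ Icc (0 : ℝ) 1, h (exp l' * cos s) ≤ h (q * (exp l' * cos s))) :
    angularSpeed ω h l' s ≤ angularSpeed ω h l s := by
  have := hmono (exp (l - l')) ⟨(exp_pos _).le, exp_le_one_iff.2 (by linarith)⟩
  rw [← mul_assoc, ← exp_add, sub_add_cancel] at this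
  have hω := H.ω_pos
  unfold angularSpeed
  gcongr

theorem abs_arctan_sub_le (a b : ℝ) : |arctan a - arctan b| ≤ |a - b| := by
  have := Convex.norm_image_sub_le_of_norm_hasDerivWithin_le (C := 1)
    (fun x _ => (hasDerivAt_arctan x).hasDerivWithinAt) (fun x _ => by
      have : 1 ≤ 1 + x ^ 2 := by nlinarith [sq_nonneg x]
      rw [Real.norm_eq_abs, abs_of_pos (by positivity), div_le_one (by positivity)]
      exact this) convex_univ (mem_univ b) (mem_univ a)
  simpa using this

/-- The coefficients `B`, `h` turn the Liénard equation into the planar system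
`x' = ω y - x B(x)`, `y' = -ω x h(x) - y B(x)` for `|x| < η₀`. -/
structure IsPlanarReduction (ω η₀ : ℝ) (f g B h : ℝ → ℝ) : Prop where
  hasDerivAt : ∀ x, |x| < η₀ → HasDerivAt (fun x => x * B x) (f x - B x) x
  h_eq : ∀ x, |x| < η₀ → ω ^ 2 * (x * h x) = g x - x * B x ^ 2

theorem IsPlanarReduction.exists_polarRep {ω L η₀ η : ℝ} {f g B h : ℝ → ℝ}
    (H : PlanarBounds ω L B h) (R : IsPlanarReduction ω η₀ f g B h) (hη : 0 < η) (hη1 : η ≤ 1)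
    (hη₀ : η < η₀) {u : ℝ → ℝ} (hu : IsLienardSolution f g u) {c T : ℝ} (hc : 0 < c)
    (hcη : c < η * exp (-(8 * π)) / 2) (hu0 : u 0 = c) (hu'0 : deriv u 0 = 0)
    (hT : IsLeast {p : ℝ | 0 < p ∧ ∀ t, u (t + p) = u t} T) :
    ∃ y l τ : ℝ → ℝ, IsPolarRep ω B h univ u y l τ ∧ (∀ s, l s ≤ log η) ∧
      τ (arctan (B c / ω)) = 0 ∧ ∀ s, τ (s - 2 * π) = τ s + T := by
  have hω := H.ω_pos
  have hBc : Continuous B := (LipschitzWith.of_dist_le_mul (K := ⟨L, H.L_nonneg⟩)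
    (fun a b => H.lipB a b)).continuous
  have hud : ∀ t, HasDerivAt u (deriv u t) t := fun t =>
    (hu.1.differentiable (by norm_num) t).hasDerivAt
  have hu'1 : ContDiff ℝ 1 (deriv u) := (contDiff_succ_iff_deriv.1 hu.1).2.2
  have hud' : ∀ t, HasDerivAt (deriv u) (deriv (deriv u) t) t := fun t =>
    (hu'1.differentiable (by norm_num) t).hasDerivAt
  have huc : Continuous u := hu.1.continuous
  set y : ℝ → ℝ := fun t => (deriv u t + u t * B (u t)) / ω with hy
  have hyc : Continuous y := (hu'1.continuous.add (huc.mul (hBc.comp huc))).div_const _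
  have huT : ∀ t, u (t + T) = u t := hT.1.2
  have hu'T : ∀ t, deriv u (t + T) = deriv u t := fun t => by
    rw [← deriv_comp_add_const, funext huT]
  have hyT : ∀ t, y (t + T) = y t := fun t => by simp only [hy, huT, hu'T]
  have hsmall : ∀ t, u t ^ 2 + y t ^ 2 ≤ η ^ 2 → |u t| < η₀ := fun t ht =>
    (abs_le_of_sq_le_sq (by nlinarith [sq_nonneg (y t)]) hη.le).trans_lt hη₀
  have hdx : ∀ t, HasDerivAt u (ω * y t - u t * B (u t)) t := fun t =>
    (hud t).congr_deriv (by simp only [hy]; field_simp; ring)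
  have hdy : ∀ t, u t ^ 2 + y t ^ 2 ≤ η ^ 2 →
      HasDerivAt y (-(ω * u t * h (u t)) - y t * B (u t)) t := fun t ht => by
    have h1 := (((hud' t).fun_add
      ((R.hasDerivAt _ (hsmall t ht)).comp t (hud t))).div_const ω)
    refine h1.congr_deriv ?_
    have h2 := R.h_eq _ (hsmall t ht)
    have h3 := hu.2 t
    rw [div_eq_iff hω.ne']
    simp only [hy]
    field_simp
    linear_combination h3 + h2
  set φ := arctan (B c / ω) with hφ
  have hsq : 0 < √(1 + (B c / ω) ^ 2) := by positivity
  set r := c * √(1 + (B c / ω) ^ 2) with hr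
  have hrpos : 0 < r := by positivity
  have hx0 : u 0 = r * cos φ := by
    rw [hu0, hφ, cos_arctan, hr]; field_simp
  have hy0 : y 0 = r * sin φ := by
    simp only [hy, hu'0, hu0]
    rw [hφ, sin_arctan, hr]; field_simp; ring
  have hr2 : r ≤ 2 * c := by
    have h1 : |B c / ω| ≤ 1 / 2 := by
      rw [abs_div, abs_of_pos hω, div_le_iff₀ hω]; linarith [H.bddB c]
    have h2 : √(1 + (B c / ω) ^ 2) ≤ 2 := by
      rw [sqrt_le_left (by norm_num)]
      nlinarith [sq_le_sq' (abs_le.1 h1).1 (abs_le.1 h1).2]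
    nlinarith
  have hrη : log r < log η - 8 * π := by
    rw [show log η - 8 * π = log (η * exp (-(8 * π))) by
      rw [log_mul hη.ne' (exp_pos _).ne', log_exp]; ring]
    exact log_lt_log hrpos (by linarith)
  have hlt := H.normSq_lt huc hyc hT.1.1 huT hyT hη hη1 (fun t _ => hdx t) hdy hrpos hx0 hy0 hrη
  have hz : IsPlanarSolutionOn ω B h univ u y :=
    ⟨huc, hyc, fun t _ => hdx t, fun t _ => hdy t (hlt t).le⟩
  obtain ⟨l, τ, hrep, -, hτφ⟩ := hz.exists_polarRep H ordConnected_univ continuous_id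
    (fun _ => mem_univ _) (fun _ _ => rfl) (mem_univ _) hrpos hx0 hy0
  have hl : ∀ s, l s ≤ log η := by
    intro s
    have h1 := (hlt (τ s)).le
    rw [hrep.x_eq s (mem_univ _), hrep.y_eq s (mem_univ _)] at h1
    rw [le_log_iff_exp_le hη]
    refine le_of_sq_le_sq ?_ hη.le
    calc exp (l s) ^ 2 = (exp (l s) * cos s) ^ 2 + (exp (l s) * sin s) ^ 2 := by
          linear_combination -exp (l s) ^ 2 * sin_sq_add_cos_sq s
      _ ≤ _ := h1
  exact ⟨y, l, τ, hrep, hl, hτφ, hrep.sub_two_pi H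
    (fun s => (hl s).trans (log_nonpos hη.le hη1)) hT.1.1 huT hyT
    fun p hp hup => hT.2 ⟨hp, hup⟩⟩

theorem IsPlanarReduction.period_mono {ω L η₀ η δ : ℝ} {f g B h T : ℝ → ℝ}
    (H : PlanarBounds ω L B h) (R : IsPlanarReduction ω η₀ f g B h) (hη : 0 < η) (hη1 : η ≤ 1)
    (hη₀ : η < η₀) (hηL : 6 * (η * L) ≤ ω)
    (hsol : ∀ c ∈ Ioo (0:ℝ) δ, ∃ u, IsLienardSolution f g u ∧ u 0 = c ∧ deriv u 0 = 0)
    (hT : ∀ c ∈ Ioo (0:ℝ) δ, ∀ u, IsLienardSolution f g u → u 0 = c → deriv u 0 = 0 →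
      IsLeast {p : ℝ | 0 < p ∧ ∀ t, u (t + p) = u t} (T c)) :
    ((∀ x, |x| < η₀ → ∀ q ∈ Icc (0 : ℝ) 1, h (q * x) ≤ h x) →
      AntitoneOn T (Ioo 0 (min δ (η * exp (-(8 * π)) / 2)))) ∧
    ((∀ x, |x| < η₀ → ∀ q ∈ Icc (0 : ℝ) 1, h x ≤ h (q * x)) →
      MonotoneOn T (Ioo 0 (min δ (η * exp (-(8 * π)) / 2)))) := by
  have key : ∀ c₁ ∈ Ioo 0 (min δ (η * exp (-(8 * π)) / 2)),
      ∀ c₂ ∈ Ioo 0 (min δ (η * exp (-(8 * π)) / 2)), c₁ < c₂ →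
      ∃ x₁ y₁ l₁ τ₁ x₂ y₂ l₂ τ₂, IsPolarRep ω B h univ x₁ y₁ l₁ τ₁ ∧
        IsPolarRep ω B h univ x₂ y₂ l₂ τ₂ ∧ (∀ s, τ₁ (s - 2 * π) = τ₁ s + T c₁) ∧
        (∀ s, τ₂ (s - 2 * π) = τ₂ s + T c₂) ∧ (∀ s, l₁ s ≤ l₂ s) ∧
        ∀ s, |exp (l₂ s) * cos s| < η₀ := by
    intro c₁ h₁ c₂ h₂ h12
    have h₁' := lt_min_iff.1 h₁.2
    have h₂' := lt_min_iff.1 h₂.2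
    obtain ⟨u₁, hu₁, hu₁0, hu₁'⟩ := hsol c₁ ⟨h₁.1, h₁'.1⟩
    obtain ⟨u₂, hu₂, hu₂0, hu₂'⟩ := hsol c₂ ⟨h₂.1, h₂'.1⟩
    obtain ⟨y₁, l₁, τ₁, hr₁, hl₁, hφ₁, hT₁⟩ := R.exists_polarRep H hη hη1 hη₀ hu₁ h₁.1 h₁'.2 hu₁0
      hu₁' (hT c₁ ⟨h₁.1, h₁'.1⟩ u₁ hu₁ hu₁0 hu₁')
    obtain ⟨y₂, l₂, τ₂, hr₂, hl₂, hφ₂, hT₂⟩ := R.exists_polarRep H hη hη1 hη₀ hu₂ h₂.1 h₂'.2 hu₂0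
      hu₂' (hT c₂ ⟨h₂.1, h₂'.1⟩ u₂ hu₂ hu₂0 hu₂')
    refine ⟨u₁, y₁, l₁, τ₁, u₂, y₂, l₂, τ₂, hr₁, hr₂, hT₁, hT₂, ?_, ?_⟩
    · refine hr₁.le_of_lt H hη hη1 hηL hr₂ hl₁ hl₂ hφ₁ hφ₂ ?_ (cos_arctan_pos _)
        (by rwa [hu₁0, hu₂0])
      refine (abs_arctan_sub_le _ _).trans ?_
      rw [← sub_div, abs_div, abs_of_pos H.ω_pos, hu₁0, hu₂0, div_mul_eq_mul_div]
      exact div_le_div_of_nonneg_right (H.lipB _ _) H.ω_pos.le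
    · intro s
      rw [abs_mul, abs_of_pos (exp_pos _)]
      have h3 : exp (l₂ s) ≤ η := (le_log_iff_exp_le hη).1 (hl₂ s)
      calc exp (l₂ s) * |cos s| ≤ η * 1 :=
            mul_le_mul h3 (abs_cos_le_one s) (abs_nonneg _) hη.le
        _ < η₀ := by linarith
  constructor
  · intro hmono c₁ h₁ c₂ h₂ h12
    rcases h12.eq_or_lt with rfl | h12
    · exact le_rfl
    obtain ⟨x₁, y₁, l₁, τ₁, x₂, y₂, l₂, τ₂, hr₁, hr₂, hT₁, hT₂, hle, hlt⟩ := key c₁ h₁ c₂ h₂ h12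
    exact IsPolarRep.period_le H hr₁ hr₂ hT₁ hT₂ fun s =>
      H.angularSpeed_le (hle s) (hmono _ (hlt s))
  · intro hmono c₁ h₁ c₂ h₂ h12
    rcases h12.eq_or_lt with rfl | h12
    · exact le_rfl
    obtain ⟨x₁, y₁, l₁, τ₁, x₂, y₂, l₂, τ₂, hr₁, hr₂, hT₁, hT₂, hle, hlt⟩ := key c₁ h₁ c₂ h₂ h12
    exact IsPolarRep.period_le H hr₂ hr₁ hT₂ hT₁ fun s =>
      H.le_angularSpeed_of_le (hle s) (hmono _ (hlt s))

/-- A function that is `C¹` at `0` agrees near `0` with a globally Lipschitz function staying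
close to its value at `0`. -/
theorem exists_lipschitz_clamp {φ : ℝ → ℝ} (hφ : ContDiffAt ℝ 1 φ 0) {ε : ℝ} (hε : 0 < ε) :
    ∃ r₁ > 0, ∀ r, 0 < r → r ≤ r₁ → ∃ (ψ : ℝ → ℝ) (K : ℝ), Continuous ψ ∧
      (∀ x y, |ψ x - ψ y| ≤ K * |x - y|) ∧ (∀ x, |x| ≤ r → ψ x = φ x) ∧
      ∀ x, |ψ x - φ 0| ≤ ε := by
  obtain ⟨K, t, ht, hK⟩ := hφ.exists_lipschitzOnWith
  have hc : ∀ᶠ x in nhds 0, |φ x - φ 0| < ε := by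
    simpa [Real.dist_eq] using Metric.continuousAt_iff'.1 hφ.continuousAt ε hε
  obtain ⟨r₂, hr₂, hsub⟩ := Metric.mem_nhds_iff.1 (Filter.inter_mem ht hc)
  refine ⟨r₂ / 2, half_pos hr₂, fun r hr hrr => ?_⟩
  have hrr' : -r ≤ r := by linarith
  have hmem : ∀ x, (projIcc (-r) r hrr' x : ℝ) ∈ Metric.ball (0 : ℝ) r₂ := fun x => by
    have := (projIcc (-r) r hrr' x).2
    rw [mem_ball_zero_iff, Real.norm_eq_abs]
    exact (abs_le.2 ⟨this.1, this.2⟩).trans_lt (by linarith)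
  have hlip : ∀ x y, |φ (projIcc (-r) r hrr' x) - φ (projIcc (-r) r hrr' y)| ≤ K * |x - y| := by
    intro x y
    have h1 := hK.dist_le_mul _ (hsub (hmem x)).1 _ (hsub (hmem y)).1
    have h2 := (LipschitzWith.projIcc hrr').dist_le_mul x y
    rw [Subtype.dist_eq] at h2
    simp only [Real.dist_eq, NNReal.coe_one, one_mul] at h1 h2
    exact h1.trans (by gcongr)
  refine ⟨fun x => φ (projIcc (-r) r hrr' x), K,
    (LipschitzWith.of_dist_le_mul (K := K) fun x y => hlip x y).continuous, hlip, ?_, ?_⟩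
  · intro x hx
    simp only [projIcc_of_mem hrr' (abs_le.1 hx)]
  · intro x
    exact (hsub (hmem x)).2.le

theorem abs_integral_weight_le {w ψ : ℝ → ℝ} {M : ℝ} (hw : ∀ s ∈ Ioc (0 : ℝ) 1, |w s| ≤ 1)
    (hψ : ∀ s ∈ Ioc (0 : ℝ) 1, |ψ s| ≤ M) : |∫ s in (0 : ℝ)..1, w s * ψ s| ≤ M := by
  have := intervalIntegral.norm_integral_le_of_norm_le_const (a := 0) (b := 1) (C := M)
    (f := fun s => w s * ψ s) (fun s hs => by
      rw [uIoc_of_le zero_le_one] at hs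
      rw [Real.norm_eq_abs, abs_mul]
      nlinarith [hw s hs, hψ s hs, abs_nonneg (ψ s), abs_nonneg (w s)])
  simpa using this

theorem abs_integral_weight_sub_le {w φ : ℝ → ℝ} {K : ℝ} (hwc : Continuous w) (hφc : Continuous φ)
    (hw : ∀ s ∈ Ioc (0 : ℝ) 1, |w s| ≤ 1) (hφ : ∀ x y, |φ x - φ y| ≤ K * |x - y|) (x y : ℝ) :
    |(∫ s in (0 : ℝ)..1, w s * φ (s * x)) - ∫ s in (0 : ℝ)..1, w s * φ (s * y)| ≤
      K * |x - y| := by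
  have hK : 0 ≤ K := by simpa using (abs_nonneg _).trans (hφ 1 0)
  have hi : ∀ x, IntervalIntegrable (fun s => w s * φ (s * x)) MeasureTheory.volume 0 1 := fun x =>
    (hwc.mul (hφc.comp (continuous_id.mul continuous_const))).intervalIntegrable _ _
  rw [← intervalIntegral.integral_sub (hi x) (hi y)]
  simp only [← mul_sub]
  refine abs_integral_weight_le hw fun s hs => (hφ _ _).trans ?_
  rw [← mul_sub, abs_mul, abs_of_pos hs.1]
  nlinarith [hs.2, mul_nonneg hK (abs_nonneg (x - y))]

theorem exists_planarReduction {f g : ℝ → ℝ} {ω : ℝ} (hω : 0 < ω) (hf : ContDiffAt ℝ 1 f 0)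
    (hg : ContDiffAt ℝ 2 g 0) (hf0 : f 0 = 0) (hg0 : g 0 = 0) (hgω : deriv g 0 = ω ^ 2) :
    ∃ r₁ > 0, ∀ η₀, 0 < η₀ → η₀ ≤ r₁ → (∀ x, |x| ≤ η₀ → DifferentiableAt ℝ g x) →
      ∃ (L : ℝ) (B h : ℝ → ℝ), PlanarBounds ω L B h ∧ IsPlanarReduction ω η₀ f g B h ∧
        ∀ x, |x| < η₀ → x ^ 2 * B x = ∫ s in (0 : ℝ)..x, s * f s := by
  obtain ⟨r₁, hr₁, H₁⟩ := exists_lipschitz_clamp hf (half_pos hω)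
  obtain ⟨r₂, hr₂, H₂⟩ := exists_lipschitz_clamp (φ := deriv g)
    (hg.derivWithin (by norm_num)) (ε := ω ^ 2 / 4) (by positivity)
  refine ⟨min r₁ r₂, lt_min hr₁ hr₂, fun η₀ hη₀ hle hgd => ?_⟩
  obtain ⟨F, K, hFc, hFK, hFf, hFb⟩ := H₁ η₀ hη₀ (hle.trans (min_le_left _ _))
  obtain ⟨G, K', hGc, hGK, hGg, hGb⟩ := H₂ η₀ hη₀ (hle.trans (min_le_right _ _))
  rw [hgω] at hGb
  simp only [hf0, sub_zero] at hFb
  set B : ℝ → ℝ := fun x => ∫ s in (0 : ℝ)..1, s * F (s * x) with hB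
  set Q : ℝ → ℝ := fun x => ∫ s in (0 : ℝ)..1, 1 * G (s * x) with hQ
  have hws : ∀ s ∈ Ioc (0 : ℝ) 1, |s| ≤ 1 := fun s hs => by rw [abs_of_pos hs.1]; exact hs.2
  have hw1 : ∀ s ∈ Ioc (0 : ℝ) 1, |(1 : ℝ)| ≤ 1 := fun s _ => by simp
  have hBlip : ∀ x y, |B x - B y| ≤ K * |x - y| :=
    abs_integral_weight_sub_le continuous_id hFc hws hFK
  have hQlip : ∀ x y, |Q x - Q y| ≤ K' * |x - y| :=
    abs_integral_weight_sub_le continuous_const hGc hw1 hGK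
  have hBb : ∀ x, |B x| ≤ ω / 2 := fun x => abs_integral_weight_le hws fun s _ => hFb _
  have hQb : ∀ x, |Q x - ω ^ 2| ≤ ω ^ 2 / 4 := by
    intro x
    have h1 : Q x - ω ^ 2 = ∫ s in (0 : ℝ)..1, 1 * (G (s * x) - ω ^ 2) := by
      simp only [hQ, one_mul]
      rw [intervalIntegral.integral_sub _ (by simp)]
      · simp
      · exact (hGc.comp (continuous_id.mul continuous_const)).intervalIntegrable _ _
    rw [h1]
    exact abs_integral_weight_le hw1 fun s _ => hGb _
  have hK : 0 ≤ K := by simpa using (abs_nonneg _).trans (hFK 1 0)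
  have hK' : 0 ≤ K' := by simpa using (abs_nonneg _).trans (hGK 1 0)
  have hBint : ∀ x, x ^ 2 * B x = ∫ s in (0 : ℝ)..x, s * F s := by
    intro x
    have := intervalIntegral.mul_integral_comp_mul_right (a := 0) (b := 1)
      (f := fun s => s * F s) x
    rw [zero_mul, one_mul] at this
    rw [← this, pow_two, mul_assoc, hB, ← intervalIntegral.integral_const_mul]
    congr 1
    refine intervalIntegral.integral_congr fun s _ => ?_
    ring
  have hmemI : ∀ {x}, |x| < η₀ → ∀ s ∈ uIcc 0 x, |s| ≤ η₀ := by
    intro x hx s hs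
    have := abs_sub_left_of_mem_uIcc hs
    simp only [sub_zero] at this
    exact this.trans hx.le
  have hQint : ∀ x, |x| < η₀ → x * Q x = g x := by
    intro x hx
    have := intervalIntegral.mul_integral_comp_mul_right (a := 0) (b := 1) (f := G) x
    rw [zero_mul, one_mul] at this
    simp only [hQ, one_mul]
    rw [this, intervalIntegral.integral_eq_sub_of_hasDerivAt (f := g) (fun s hs => ?_)
      (hGc.intervalIntegrable _ _), hg0, sub_zero]
    have h1 := hmemI hx s hs
    rw [hGg s h1]
    exact (hgd s h1).hasDerivAt
  refine ⟨K + (K' + ω * K) / ω ^ 2, B, fun x => (Q x - B x ^ 2) / ω ^ 2,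
    ⟨hω, fun x y => ?_, fun x y => ?_, hBb, fun x => ?_⟩, ⟨fun x hx => ?_, fun x hx => ?_⟩,
    fun x hx => ?_⟩
  · refine (hBlip x y).trans (mul_le_mul_of_nonneg_right ?_ (abs_nonneg _))
    have : 0 ≤ (K' + ω * K) / ω ^ 2 := by positivity
    linarith
  · have h1 : |B x ^ 2 - B y ^ 2| ≤ ω * K * |x - y| := by
      rw [sq_sub_sq, abs_mul]
      have h2 : |B x + B y| ≤ ω := (abs_add_le _ _).trans (by linarith [hBb x, hBb y])
      calc _ ≤ ω * (K * |x - y|) := mul_le_mul h2 (hBlip x y) (abs_nonneg _) hω.le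
        _ = _ := by ring
    have h3 : |Q x - B x ^ 2 - (Q y - B y ^ 2)| ≤ (K' + ω * K) * |x - y| := by
      rw [show Q x - B x ^ 2 - (Q y - B y ^ 2) = Q x - Q y - (B x ^ 2 - B y ^ 2) by ring]
      refine (abs_sub _ _).trans ?_
      linarith [hQlip x y]
    rw [← sub_div, abs_div, abs_of_pos (by positivity : 0 < ω ^ 2), add_mul, div_mul_eq_mul_div]
    have := div_le_div_of_nonneg_right h3 (by positivity : 0 ≤ ω ^ 2)
    have := mul_nonneg hK (abs_nonneg (x - y))
    linarith
  · have h1 : B x ^ 2 ≤ ω ^ 2 / 4 := by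
      have := abs_le.1 (hBb x)
      nlinarith
    have h2 := abs_le.1 (hQb x)
    have hω2 : 0 < ω ^ 2 := by positivity
    rw [show (Q x - B x ^ 2) / ω ^ 2 - 1 = (Q x - ω ^ 2 - B x ^ 2) / ω ^ 2 by field_simp; ring,
      abs_div, abs_of_pos hω2, div_le_iff₀ hω2, abs_le]
    constructor <;> nlinarith [sq_nonneg (B x)]
  · rw [← hFf x hx.le]
    rcases eq_or_ne x 0 with rfl | hx0
    · have hF0 : F 0 = 0 := by rw [hFf 0 (by simpa using hη₀.le), hf0]
      have hB0 : B 0 = 0 := by simp [hB, hF0]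
      have hBc : ContinuousAt B 0 :=
        (LipschitzWith.of_dist_le_mul (K := ⟨K, hK⟩) fun a b => hBlip a b).continuous.continuousAt
      rw [hF0, hB0, sub_zero, hasDerivAt_iff_tendsto_slope]
      have h1 : Filter.Tendsto B (nhdsWithin 0 {0}ᶜ) (nhds 0) := by
        have := hBc.tendsto.mono_left (nhdsWithin_le_nhds (s := {0}ᶜ))
        rwa [hB0] at this
      refine h1.congr' ?_
      filter_upwards [self_mem_nhdsWithin] with z hz
      have hz' : z ≠ 0 := hz
      simp [slope_def_field, hz']
    · have hc : Continuous fun s => s * F s := continuous_id.mul hFc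
      have h1 : HasDerivAt (fun x => (∫ s in (0 : ℝ)..x, s * F s) / x)
          ((x * F x * x - (∫ s in (0 : ℝ)..x, s * F s) * 1) / x ^ 2) x :=
        (hc.integral_hasStrictDerivAt 0 x).hasDerivAt.fun_div (hasDerivAt_id x) hx0
      have h2 : HasDerivAt (fun x => x * B x)
          ((x * F x * x - (∫ s in (0 : ℝ)..x, s * F s) * 1) / x ^ 2) x := by
        refine h1.congr_of_eventuallyEq ?_
        filter_upwards [isOpen_ne.mem_nhds hx0] with z hz
        have hz' : z ≠ 0 := hz
        rw [← hBint z]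
        field_simp
      refine h2.congr_deriv ?_
      rw [← hBint x]
      field_simp
  · rw [← hQint x hx]
    field_simp
  · rw [hBint x]
    refine intervalIntegral.integral_congr fun s hs => ?_
    simp only [hFf s (hmemI hx s hs)]

theorem le_of_radial_deriv_nonneg {h h' : ℝ → ℝ} {η₀ : ℝ} (hc : Continuous h)
    (hd : ∀ x, x ≠ 0 → |x| < η₀ → HasDerivAt h (h' x) x)
    (hs : ∀ x, x ≠ 0 → |x| < η₀ → 0 ≤ x * h' x) (x : ℝ) (hx : |x| < η₀) (q : ℝ)
    (hq : q ∈ Icc (0 : ℝ) 1) : h (q * x) ≤ h x := by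
  rcases eq_or_ne x 0 with rfl | hx0
  · simp
  have hmem : ∀ p ∈ Ioo (0 : ℝ) 1, p * x ≠ 0 ∧ |p * x| < η₀ := fun p hp =>
    ⟨mul_ne_zero hp.1.ne' hx0, by
      rw [abs_mul, abs_of_pos hp.1]
      nlinarith [hp.2, abs_nonneg x]⟩
  have hpd : ∀ p ∈ Ioo (0 : ℝ) 1, HasDerivAt (fun p => h (p * x)) (h' (p * x) * x) p :=
    fun p hp => by
      have h1 := hd _ (hmem p hp).1 (hmem p hp).2
      exact (HasDerivAt.comp p h1 ((hasDerivAt_id p).mul_const x)).congr_deriv (by simp)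
  have hmono : MonotoneOn (fun p => h (p * x)) (Icc 0 1) := by
    refine monotoneOn_of_deriv_nonneg (convex_Icc 0 1)
      (hc.comp (continuous_id.mul continuous_const)).continuousOn ?_ ?_
    · rw [interior_Icc]
      exact fun p hp => (hpd p hp).differentiableAt.differentiableWithinAt
    · rw [interior_Icc]
      intro p hp
      rw [(hpd p hp).deriv]
      have := hs _ (hmem p hp).1 (hmem p hp).2
      rw [mul_assoc] at this
      rw [mul_comm]
      exact nonneg_of_mul_nonneg_right this hp.1
  simpa using hmono hq (right_mem_Icc.2 zero_le_one) hq.2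

/-- Suppose `f, g` are `C³`, `f(0) = g(0) = 0`, `g'(0) > 0`, `g''(0) = 0`, `f''(0) = 0`, the
origin is a center of the Liénard equation with period function `T`, and `x·C(x) > 0` on a
punctured neighborhood `J` of `0`. With `F(x) = ∫₀ˣ s f(s) ds`, `gₙ(x) = g(x)/g'(0) − x` and
`σ(x) = (2/g'(0))x²f(x)F(x) − (4/g'(0))F(x)² + x³gₙ(x) − x⁴gₙ'(x)`: if `σ ≤ 0` on `J` then
`T` is decreasing near `0`; if `σ ≥ 0` on `J` then `T` is increasing near `0`; if `σ ≡ 0` on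
`J` then `T` is constant near `0`. -/
theorem lienard_period_monotonicity_of_sigma
    (a b : ℝ) (ha : a < 0) (hb : 0 < b) (f g : ℝ → ℝ)
    (hf : ContDiffOn ℝ 3 f (Ioo a b)) (hg : ContDiffOn ℝ 3 g (Ioo a b))
    (hf0 : f 0 = 0) (hg0 : g 0 = 0) (hg'0 : 0 < deriv g 0)
    (hg''0 : iteratedDeriv 2 g 0 = 0) (hf''0 : iteratedDeriv 2 f 0 = 0)
    (δ : ℝ) (hδ : 0 < δ) (T : ℝ → ℝ)
    (hsol : ∀ c ∈ Ioo (0:ℝ) δ, ∃ u, IsLienardSolution f g u ∧ u 0 = c ∧ deriv u 0 = 0)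
    (hcenter : ∀ c ∈ Ioo (0:ℝ) δ, ∀ u, IsLienardSolution f g u → u 0 = c → deriv u 0 = 0 →
      ∃ p > 0, ∀ t, u (t + p) = u t)
    (hT : ∀ c ∈ Ioo (0:ℝ) δ, ∀ u, IsLienardSolution f g u → u 0 = c → deriv u 0 = 0 →
      IsLeast {p : ℝ | 0 < p ∧ ∀ t, u (t + p) = u t} (T c))
    (F : ℝ → ℝ) (hF : ∀ x, F x = ∫ s in (0:ℝ)..x, s * f s)
    (gn : ℝ → ℝ) (hgn : ∀ x, gn x = g x / deriv g 0 - x)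
    (C : ℝ → ℝ)
    (hC : ∀ x : ℝ, x ≠ 0 → C x = g x / deriv g 0 - (F x) ^ 2 / (deriv g 0 * x ^ 3))
    (hC0 : C 0 = 0)
    (σ : ℝ → ℝ)
    (hσ : ∀ x, σ x = (2 / deriv g 0) * x ^ 2 * f x * F x - (4 / deriv g 0) * (F x) ^ 2
      + x ^ 3 * gn x - x ^ 4 * deriv gn x)
    (ρ : ℝ) (hρ : 0 < ρ)
    (hxC : ∀ x ∈ Ioo (-ρ) ρ, x ≠ 0 → 0 < x * C x) :
    ((∀ x ∈ Ioo (-ρ) ρ, x ≠ 0 → σ x ≤ 0) →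
      ∃ ε, 0 < ε ∧ ε ≤ δ ∧ AntitoneOn T (Ioo 0 ε)) ∧
    ((∀ x ∈ Ioo (-ρ) ρ, x ≠ 0 → 0 ≤ σ x) →
      ∃ ε, 0 < ε ∧ ε ≤ δ ∧ MonotoneOn T (Ioo 0 ε)) ∧
    ((∀ x ∈ Ioo (-ρ) ρ, x ≠ 0 → σ x = 0) →
      ∃ ε, 0 < ε ∧ ε ≤ δ ∧ ∀ c ∈ Ioo (0:ℝ) ε, ∀ c' ∈ Ioo (0:ℝ) ε, T c = T c') := by
  set ω := √(deriv g 0) with hωdef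
  have hω : 0 < ω := sqrt_pos.2 hg'0
  have hgω : deriv g 0 = ω ^ 2 := (sq_sqrt hg'0.le).symm
  have hab : Ioo a b ∈ nhds (0 : ℝ) := Ioo_mem_nhds ha hb
  obtain ⟨r₁, hr₁, H₁⟩ := exists_planarReduction hω ((hf.contDiffAt hab).of_le (by norm_num))
    ((hg.contDiffAt hab).of_le (by norm_num)) hf0 hg0 hgω
  set m := min (min (-a) b) ρ with hm
  have hmpos : 0 < m := lt_min (lt_min (neg_pos.2 ha) hb) hρ
  set η₀ := min r₁ (m / 2) with hη₀def
  have hη₀ : 0 < η₀ := lt_min hr₁ (half_pos hmpos)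
  have hη₀m : η₀ < m := (min_le_right _ _).trans_lt (half_lt_self hmpos)
  have hmem : ∀ x, |x| ≤ η₀ → x ∈ Ioo a b := fun x hx => by
    have h1 := abs_le.1 (hx.trans hη₀m.le)
    have h2 := abs_lt.1 (hx.trans_lt hη₀m)
    have h3 : m ≤ -a := (min_le_left _ _).trans (min_le_left _ _)
    have h4 : m ≤ b := (min_le_left _ _).trans (min_le_right _ _)
    exact ⟨by linarith, by linarith⟩
  have hmemρ : ∀ x, |x| < η₀ → x ∈ Ioo (-ρ) ρ := fun x hx =>
    abs_lt.1 (hx.trans (hη₀m.trans_le (min_le_right _ _)))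
  have hgd : ∀ x, |x| ≤ η₀ → DifferentiableAt ℝ g x := fun x hx =>
    (hg.contDiffAt (isOpen_Ioo.mem_nhds (hmem x hx))).differentiableAt (by norm_num)
  obtain ⟨L, B, h, HP, R, hBF⟩ := H₁ η₀ hη₀ (min_le_left _ _) hgd
  simp only [← hF] at hBF
  have hL := HP.L_nonneg
  have hhc : Continuous h := (LipschitzWith.of_dist_le_mul (K := ⟨L, hL⟩)
    (fun a b => HP.liph a b)).continuous
  have hFd : ∀ x, x ≠ 0 → |x| < η₀ → HasDerivAt F (x * f x) x := fun x hx0 hx => by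
    have h1 := (hasDerivAt_id x).fun_mul (R.hasDerivAt x hx)
    refine (h1.congr_of_eventuallyEq ?_).congr_deriv ?_
    · filter_upwards [(isOpen_lt continuous_abs continuous_const).mem_nhds hx] with z hz
      rw [← hBF z hz, id]; ring
    · simp only [id]; ring
  have hhd : ∀ x, x ≠ 0 → |x| < η₀ → HasDerivAt h (-(σ x / x ^ 5)) x := fun x hx0 hx => by
    have h1 : HasDerivAt (fun x => g x / (ω ^ 2 * x) - F x ^ 2 / (ω ^ 2 * x ^ 4)) _ x :=
      ((hgd x hx.le).hasDerivAt.fun_div ((hasDerivAt_id x).const_mul (ω ^ 2))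
        (by positivity)).fun_sub (((hFd x hx0 hx).fun_pow 2).fun_div
          ((hasDerivAt_pow 4 x).const_mul (ω ^ 2)) (by positivity))
    refine (h1.congr_of_eventuallyEq ?_).congr_deriv ?_
    · filter_upwards [(isOpen_lt continuous_abs continuous_const).mem_nhds hx,
        isOpen_ne.mem_nhds hx0] with z hz hz0
      have hz0' : z ≠ 0 := hz0
      have h2 := R.h_eq z hz
      rw [← hBF z hz]
      field_simp
      linear_combination h2
    · have hgnd : deriv gn x = deriv g x / ω ^ 2 - 1 := by
        rw [show gn = fun x => g x / deriv g 0 - x from funext hgn, hgω]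
        exact (((hgd x hx.le).hasDerivAt.div_const _).fun_sub (hasDerivAt_id x)).deriv
      rw [hσ, hgnd, hgn, hgω]
      simp only [id]
      push_cast
      field_simp
      ring
  set η := min (min 1 (η₀ / 2)) (ω / (6 * (L + 1))) with hη
  have hηpos : 0 < η := lt_min (lt_min one_pos (half_pos hη₀)) (by positivity)
  have hη1 : η ≤ 1 := (min_le_left _ _).trans (min_le_left _ _)
  have hηη₀ : η < η₀ :=
    ((min_le_left _ _).trans (min_le_right _ _)).trans_lt (half_lt_self hη₀)
  have hηL : 6 * (η * L) ≤ ω := by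
    have h1 : η * (6 * (L + 1)) ≤ ω := (le_div_iff₀ (by positivity)).1 (min_le_right _ _)
    nlinarith
  obtain ⟨hanti, hmono⟩ := R.period_mono HP hηpos hη1 hηη₀ hηL hsol hT
  set ε := min δ (η * exp (-(8 * π)) / 2) with hε
  have hεpos : 0 < ε := lt_min hδ (by positivity)
  have hsgn : ∀ x : ℝ, x ≠ 0 → x * -(σ x / x ^ 5) = -σ x / x ^ 4 := fun x hx => by
    field_simp
  have Hanti : (∀ x ∈ Ioo (-ρ) ρ, x ≠ 0 → σ x ≤ 0) → AntitoneOn T (Ioo 0 ε) := fun hs =>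
    hanti (le_of_radial_deriv_nonneg hhc hhd fun x hx0 hx => by
      rw [hsgn x hx0]
      exact div_nonneg (neg_nonneg.2 (hs x (hmemρ x hx) hx0)) (by positivity))
  have Hmono : (∀ x ∈ Ioo (-ρ) ρ, x ≠ 0 → 0 ≤ σ x) → MonotoneOn T (Ioo 0 ε) := fun hs =>
    hmono fun x hx q hq => neg_le_neg_iff.1 <|
      le_of_radial_deriv_nonneg (h := fun x => -h x) hhc.neg
        (fun x hx0 hx => (hhd x hx0 hx).fun_neg) (fun x hx0 hx => by
          rw [mul_neg, hsgn x hx0, neg_div, neg_neg]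
          exact div_nonneg (hs x (hmemρ x hx) hx0) (by positivity)) x hx q hq
  refine ⟨fun hs => ⟨ε, hεpos, min_le_left _ _, Hanti hs⟩,
    fun hs => ⟨ε, hεpos, min_le_left _ _, Hmono hs⟩,
    fun hs => ⟨ε, hεpos, min_le_left _ _, fun c hc c' hc' => ?_⟩⟩
  have h1 := Hanti fun x hx hx0 => (hs x hx hx0).le
  have h2 := Hmono fun x hx hx0 => (hs x hx hx0).ge
  rcases le_total c c' with hcc | hcc
  · exact le_antisymm (h2 hc hc' hcc) (h1 hc hc' hcc)
  · exact le_antisymm (h1 hc' hc hcc) (h2 hc' hc hcc)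
end
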